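/- arXiv:2605.22397 — 3 statements merged into one kernel-verified Lean document; each statement's English description precedes it below -/
import Mathlib

section
/- For every integer t ≥ 1 there exists n_0 such that for all n ≥ n_0: ex_3(n, F_sim(t)) = max{ abc + t(C(a,2) + C(b,2) + C(c,2)) : a, b, c positive integers with a + b + c = n − t } + C(t,3), where C(x,2) and C(t,3) denote binomial coefficients. -/
open Finset

/-- `H` (a 3-graph given by its edge set on vertex type `V`) contains a copy of the
3-graph `F` (given by its edge set on vertex type `W`). -/
def HasCopy {V W : Type*} [DecidableEq V] [DecidableEq W]
    (H : Finset (Finset V)) (F : Finset (Finset W)) : Prop :=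
  ∃ f : W ↪ V, ∀ e ∈ F, e.image f ∈ H

/-- The Turán number `ex_3(n, F)`: the maximum number of hyperedges of an `F`-free
3-uniform hypergraph on `n` vertices. -/
noncomputable def exThree {W : Type*} [DecidableEq W] (n : ℕ) (F : Finset (Finset W)) : ℕ :=
  sSup {k | ∃ H : Finset (Finset (Fin n)), (∀ e ∈ H, e.card = 3) ∧ ¬ HasCopy H F ∧ H.card = k}

/-- The `i`-th part of the balanced tripartition of `Fin n` (vertices with residue `i` mod 3);
the parts have sizes `⌊n/3⌋` or `⌈n/3⌉`. -/
def turanPart (n : ℕ) (i : Fin 3) : Finset (Fin n) :=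
  Finset.univ.filter (fun v => (v : ℕ) % 3 = (i : ℕ))

/-- The balanced complete tripartite 3-graph `T_3(n,3)`: hyperedges are exactly the triples
with one vertex in each part of the balanced tripartition. -/
def T3 (n : ℕ) : Finset (Finset (Fin n)) :=
  Finset.univ.filter (fun e => e.card = 3 ∧ ∀ i : Fin 3, (e ∩ turanPart n i).card = 1)

/-- The 3-graph `F_5` on `{f_1, …, f_5}` with hyperedges `f_1f_2f_3, f_1f_2f_4, f_3f_4f_5`. -/
def F5 : Finset (Finset (Fin 5)) := {{0,1,2},{0,1,3},{2,3,4}}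

/-- `F_5(f_5;t)`: `F_5` with the vertex `f_5` blown up to `t` copies.
Here `inl 0, inl 1, inl 2, inl 3` play the roles of `f_1,f_2,f_3,f_4` and the
vertices `inr j` are the `t` copies of `f_5`. -/
def F5b5 (t : ℕ) : Finset (Finset (Fin 4 ⊕ Fin t)) :=
  ({({Sum.inl 0, Sum.inl 1, Sum.inl 2} : Finset (Fin 4 ⊕ Fin t)),
    ({Sum.inl 0, Sum.inl 1, Sum.inl 3} : Finset (Fin 4 ⊕ Fin t))} :
      Finset (Finset (Fin 4 ⊕ Fin t))) ∪
  Finset.univ.image (fun j : Fin t => ({Sum.inl 2, Sum.inl 3, Sum.inr j} : Finset (Fin 4 ⊕ Fin t)))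

/-- `F_5(f_3;t)`: `F_5` with the vertex `f_3` blown up to `t` copies.
Here `inl 0, inl 1, inl 2, inl 3` play the roles of `f_1,f_2,f_4,f_5` and the
vertices `inr j` are the `t` copies of `f_3`. -/
def F5b3 (t : ℕ) : Finset (Finset (Fin 4 ⊕ Fin t)) :=
  ({({Sum.inl 0, Sum.inl 1, Sum.inl 2} : Finset (Fin 4 ⊕ Fin t))} :
      Finset (Finset (Fin 4 ⊕ Fin t))) ∪
  Finset.univ.image (fun j : Fin t => ({Sum.inl 0, Sum.inl 1, Sum.inr j} : Finset (Fin 4 ⊕ Fin t))) ∪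
  Finset.univ.image (fun j : Fin t => ({Sum.inr j, Sum.inl 2, Sum.inl 3} : Finset (Fin 4 ⊕ Fin t)))

/-- `S^t(N)` (the size of `D(N,3,t,2)`): the maximum number of hyperedges of a 3-graph on `N`
vertices in which every pair of vertices is contained in at most `t-1` hyperedges. -/
noncomputable def Dmax (N t : ℕ) : ℕ :=
  sSup {k | ∃ H : Finset (Finset (Fin N)), (∀ e ∈ H, e.card = 3) ∧
    (∀ u v : Fin N, u ≠ v → (H.filter (fun e => u ∈ e ∧ v ∈ e)).card ≤ t - 1) ∧ H.card = k}

/-- `e(T_3(n,3)^{t+})`: the number of hyperedges of `T_3(n,3)` together with a maximum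
3-graph inside each part in which every pair of vertices lies in at most `t-1` hyperedges. -/
noncomputable def eT3plus (n t : ℕ) : ℕ :=
  (T3 n).card + ∑ i : Fin 3, Dmax ((turanPart n i).card) t

/-- `F` is a subgraph of a blow-up of `F_5`: every edge is a triple, and there is a map
to `V(F_5)` that is injective on each edge and sends each edge to an edge of `F_5`. -/
def IsSubBlowupF5 {W : Type*} [DecidableEq W] (F : Finset (Finset W)) : Prop :=
  (∀ e ∈ F, e.card = 3) ∧ ∃ φ : W → Fin 5, ∀ e ∈ F, (e.image φ).card = 3 ∧ e.image φ ∈ F5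

/-- The complete tripartite 3-graph with parts `A`, `B`, `C`: all triples with exactly
one vertex in each of `A`, `B`, `C`. -/
def tripartiteEdges {n : ℕ} (A B C : Finset (Fin n)) : Finset (Finset (Fin n)) :=
  Finset.univ.filter (fun e =>
    (e ∩ A).card = 1 ∧ (e ∩ B).card = 1 ∧ (e ∩ C).card = 1 ∧ e.card = 3)

/-- The complete 3-partite 3-graph `K_{t,s,s}` with parts of sizes `t`, `s`, `s`. -/
def Ktss (t s : ℕ) : Finset (Finset (Fin t ⊕ Fin s ⊕ Fin s)) :=
  Finset.univ.image (fun x : Fin t × Fin s × Fin s =>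
    ({Sum.inl x.1, Sum.inr (Sum.inl x.2.1), Sum.inr (Sum.inr x.2.2)} :
      Finset (Fin t ⊕ Fin s ⊕ Fin s)))

/-- All hyperedges of `H` consist of one vertex of the `A`-side (`Fin mA`) and two
vertices of the `B`-side (`Fin nB`). -/
def BipShape (mA nB : ℕ) (H : Finset (Finset (Fin mA ⊕ Fin nB))) : Prop :=
  ∀ e ∈ H, ∃ a : Fin mA, ∃ b c : Fin nB, b ≠ c ∧
    e = ({Sum.inl a, Sum.inr b, Sum.inr c} : Finset (Fin mA ⊕ Fin nB))

/-- `H` contains a copy of `K_{t,s,s}` whose `t`-vertex part lies on the `A`-side and whose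
two `s`-vertex parts lie on the `B`-side. -/
def HasBipKtss (mA nB t s : ℕ) (H : Finset (Finset (Fin mA ⊕ Fin nB))) : Prop :=
  ∃ (T : Finset (Fin mA)) (S0 S1 : Finset (Fin nB)), T.card = t ∧
    S0.card = s ∧ S1.card = s ∧ Disjoint S0 S1 ∧
    ∀ a ∈ T, ∀ b ∈ S0, ∀ c ∈ S1,
      ({Sum.inl a, Sum.inr b, Sum.inr c} : Finset (Fin mA ⊕ Fin nB)) ∈ H

/-- The bipartite Turán number `ex_3^{bip}(mA, nB, K_{t,s,s})`. -/
noncomputable def exBip (mA nB t s : ℕ) : ℕ :=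
  sSup {k | ∃ H : Finset (Finset (Fin mA ⊕ Fin nB)),
    BipShape mA nB H ∧ ¬ HasBipKtss mA nB t s H ∧ H.card = k}

/-- The `s`-set `S_0` inside the residue-0 part of `T_3(3m,3)`. -/
def S0set (m s : ℕ) (h : 2*s ≤ m) : Finset (Fin (3*m)) :=
  Finset.univ.image (fun i : Fin s => (⟨3*i.val, by have := i.isLt; omega⟩ : Fin (3*m)))

/-- The `s`-set `S_1` inside the residue-0 part of `T_3(3m,3)`, disjoint from `S_0`. -/
def S1set (m s : ℕ) (h : 2*s ≤ m) : Finset (Fin (3*m)) :=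
  Finset.univ.image (fun i : Fin s => (⟨3*(s+i.val), by have := i.isLt; omega⟩ : Fin (3*m)))

/-- The 3-graph `F_5^S(m,t,K_{s,s})`: `T_3(3m,3)` (on the `inl` vertices) together with a set
`T` of `t` new vertices (the `inr` vertices) and all triples consisting of one vertex of `T`,
one vertex of `S_0` and one vertex of `S_1`. -/
def F5Stss (m t s : ℕ) (h : 2*s ≤ m) : Finset (Finset (Fin (3*m) ⊕ Fin t)) :=
  (T3 (3*m)).image (fun e => e.image Sum.inl) ∪
  Finset.univ.biUnion (fun j : Fin t =>
    ((S0set m s h) ×ˢ (S1set m s h)).image (fun p =>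
      ({Sum.inr j, Sum.inl p.1, Sum.inl p.2} : Finset (Fin (3*m) ⊕ Fin t))))

/-- `F_sim(t)`: the 3-graph with hyperedges `f_1f_2f_3, f_1f_2f_4, f_3f_4f_5, f_5f_6f_7,
f_6f_7f_8` in which `f_8` is blown up to `t` copies. Here `inl 0, …, inl 6` play the roles
of `f_1, …, f_7` and the vertices `inr j` are the `t` copies of `f_8`. -/
def Fsim (t : ℕ) : Finset (Finset (Fin 7 ⊕ Fin t)) :=
  ({({Sum.inl 0, Sum.inl 1, Sum.inl 2} : Finset (Fin 7 ⊕ Fin t)),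
    ({Sum.inl 0, Sum.inl 1, Sum.inl 3} : Finset (Fin 7 ⊕ Fin t)),
    ({Sum.inl 2, Sum.inl 3, Sum.inl 4} : Finset (Fin 7 ⊕ Fin t)),
    ({Sum.inl 4, Sum.inl 5, Sum.inl 6} : Finset (Fin 7 ⊕ Fin t))} :
      Finset (Finset (Fin 7 ⊕ Fin t))) ∪
  Finset.univ.image (fun j : Fin t => ({Sum.inl 5, Sum.inl 6, Sum.inr j} : Finset (Fin 7 ⊕ Fin t)))

/-- The 3-graph with parts `A`, `B`, `C` and an extra clique `X`: its hyperedges are the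
triples with one vertex in each of `A`, `B`, `C`, all 3-subsets of `X`, and the triples with
one vertex in `X` and two vertices in a common part among `A`, `B`, `C`. -/
def simConstr (n : ℕ) (A B C X : Finset (Fin n)) : Finset (Finset (Fin n)) :=
  Finset.univ.filter (fun e => e.card = 3 ∧
    (((e ∩ A).card = 1 ∧ (e ∩ B).card = 1 ∧ (e ∩ C).card = 1) ∨
     e ⊆ X ∨
     ((e ∩ X).card = 1 ∧ ((e ∩ A).card = 2 ∨ (e ∩ B).card = 2 ∨ (e ∩ C).card = 2))))

/-- `F_5^S(m)`: `T_3(3m,3)` together with one new vertex `v = inr ()` and one hyperedge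
consisting of `v` and two vertices (`0` and `3`) lying in one part of `T_3(3m,3)`. -/
def F5Sm (m : ℕ) (hm : 2 ≤ m) : Finset (Finset (Fin (3*m) ⊕ Unit)) :=
  (T3 (3*m)).image (fun e => e.image Sum.inl) ∪
  {({Sum.inr (), Sum.inl ⟨0, by omega⟩, Sum.inl ⟨3, by omega⟩} : Finset (Fin (3*m) ⊕ Unit))}

/-- The disjoint union of `k` vertex-disjoint copies of the 3-graph `F`. -/
def copies (k : ℕ) {W : Type*} [DecidableEq W] (F : Finset (Finset W)) :
    Finset (Finset (Fin k × W)) :=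
  Finset.univ.biUnion (fun j : Fin k => F.image (fun e => e.image (fun w => (j, w))))

/-- The 3-graph `G(t,m,n)` (it does not depend on `m`): the vertices `v < t` form the set
`T`, the remaining `n - t` vertices carry a copy of `T_3(n-t,3)` (parts by residue of
`v - t` mod 3), and the hyperedges are those of this `T_3(n-t,3)` together with all
3-sets of vertices intersecting `T`. -/
def Gtmn (t n : ℕ) : Finset (Finset (Fin n)) :=
  Finset.univ.filter (fun e => e.card = 3 ∧
    ((∃ v ∈ e, (v : ℕ) < t) ∨
     (∀ i : Fin 3, (e.filter (fun v : Fin n => t ≤ (v : ℕ) ∧ ((v : ℕ) - t) % 3 = (i : ℕ))).card = 1)))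

/-- The blow-up of `F_5` in which every vertex is replaced by `t` copies:
the vertex `(i, j)` is the `j`-th copy of `f_{i+1}`. -/
def F5blowAll (t : ℕ) : Finset (Finset (Fin 5 × Fin t)) :=
  Finset.univ.biUnion (fun x : Fin t × Fin t × Fin t =>
    ({ ({((0:Fin 5), x.1), ((1:Fin 5), x.2.1), ((2:Fin 5), x.2.2)} : Finset (Fin 5 × Fin t)),
       ({((0:Fin 5), x.1), ((1:Fin 5), x.2.1), ((3:Fin 5), x.2.2)} : Finset (Fin 5 × Fin t)),
       ({((2:Fin 5), x.1), ((3:Fin 5), x.2.1), ((4:Fin 5), x.2.2)} : Finset (Fin 5 × Fin t)) } :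
      Finset (Finset (Fin 5 × Fin t))))

section TripleSystems

variable {V : Type*}

/-- A 3-graph viewed as a totally symmetric ternary relation on distinct vertices. -/
structure IsTripleSystem (E : V → V → V → Prop) : Prop where
  rot : ∀ {x y z}, E x y z → E y z x
  swap : ∀ {x y z}, E x y z → E y x z
  ne : ∀ {x y z}, E x y z → x ≠ y

/-- The triple system contains no copy of `F_5`. -/
def F5Free (E : V → V → V → Prop) : Prop :=
  ∀ ⦃u v x y z⦄, E u v x → E u v y → E x y z → z ≠ u → z ≠ v → False

variable {E : V → V → V → Prop}

lemma IsTripleSystem.swap' (hE : IsTripleSystem E) {x y z : V} (h : E x y z) : E x z y :=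
  hE.swap (hE.rot (hE.rot h))

lemma IsTripleSystem.ne' (hE : IsTripleSystem E) {x y z : V} (h : E x y z) : x ≠ z :=
  hE.ne (hE.swap' h)

lemma IsTripleSystem.ne'' (hE : IsTripleSystem E) {x y z : V} (h : E x y z) : y ≠ z :=
  hE.ne (hE.rot h)

variable [Fintype V]

open scoped Classical in
/-- Common neighbourhood of a pair of vertices. -/
noncomputable def nbr (E : V → V → V → Prop) (x y : V) : Finset V := {z | E x y z}

open scoped Classical in
/-- The link of a vertex, as a set of ordered pairs. -/
noncomputable def link (E : V → V → V → Prop) (x : V) : Finset (V × V) := {p | E x p.1 p.2}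

open scoped Classical in
/-- The ordered pairs meeting a given set of vertices. -/
noncomputable def touching (R : Finset V) : Finset (V × V) := {p | p.1 ∈ R ∨ p.2 ∈ R}

open scoped Classical in
/-- The set of ordered pairs of codegree at least three. -/
noncomputable def heavy (E : V → V → V → Prop) : Finset (V × V) := {p | 3 ≤ #(nbr E p.1 p.2)}

@[simp] lemma mem_nbr {x y z : V} : z ∈ nbr E x y ↔ E x y z := by simp [nbr]

@[simp] lemma mem_link {x : V} {p : V × V} : p ∈ link E x ↔ E x p.1 p.2 := by simp [link]

@[simp] lemma mem_touching {R : Finset V} {p : V × V} : p ∈ touching R ↔ p.1 ∈ R ∨ p.2 ∈ R := by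
  simp [touching]

@[simp] lemma mem_heavy {p : V × V} : p ∈ heavy E ↔ 3 ≤ #(nbr E p.1 p.2) := by simp [heavy]

lemma card_touching_le (R : Finset V) : #(touching R) ≤ 2 * #R * Fintype.card V := by
  classical
  have : touching R ⊆ R ×ˢ univ ∪ univ ×ˢ R := by
    intro p hp; simpa using hp
  refine (card_le_card this).trans ((card_union_le _ _).trans ?_)
  simp only [card_product, card_univ]
  apply le_of_eq; ring

lemma IsTripleSystem.nbr_comm (hE : IsTripleSystem E) (x y : V) : nbr E x y = nbr E y x := by
  ext z; simpa using ⟨hE.swap, hE.swap⟩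

lemma IsTripleSystem.card_link (x : V) :
    #(link E x) = ∑ y, #(nbr E x y) := by
  classical
  simp only [link, nbr, card_filter, Fintype.sum_prod_type]

lemma F5Free.not_common (hF : F5Free E) {x y u v : V} (h : 3 ≤ #(nbr E x y))
    (hx : E u v x) (hy : E u v y) : False := by
  classical
  obtain ⟨z, hz, hz'⟩ := exists_mem_notMem_of_card_lt_card
    (lt_of_le_of_lt (card_le_two (a := u) (b := v)) h)
  simp only [mem_nbr] at hz
  simp only [mem_insert, mem_singleton, not_or] at hz'
  exact hF hx hy hz hz'.1 hz'.2

lemma F5Free.disjoint_link (hE : IsTripleSystem E) (hF : F5Free E) {x y : V}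
    (h : 3 ≤ #(nbr E x y)) : Disjoint (link E x) (link E y) := by
  rw [disjoint_left]
  intro p hx hy
  simp only [mem_link] at hx hy
  exact hF.not_common h (hE.rot hx) (hE.rot hy)

/-- Turán's theorem, counting ordered pairs. -/
lemma turan_ordered_pairs (G : SimpleGraph V) {r : ℕ} (hr : 0 < r) (hG : G.CliqueFree (r + 1))
    (P : Finset (V × V)) (hP : ∀ p ∈ P, G.Adj p.1 p.2) :
    r * #P ≤ (r - 1) * Fintype.card V ^ 2 := by
  classical
  obtain ⟨T, _, hT⟩ := SimpleGraph.exists_isTuranMaximal (V := V) hr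
  have h1 := hT.2 hG
  rw [((SimpleGraph.isTuranMaximal_iff_nonempty_iso_turanGraph hr).mp hT).some.card_edgeFinset_eq]
    at h1
  have h2 := SimpleGraph.mul_card_edgeFinset_turanGraph_le (n := Fintype.card V) (r := r)
  have h3 : #P ≤ ∑ v, G.degree v := by
    have : #P ≤ #({p : V × V | G.Adj p.1 p.2}) := by
      apply card_le_card; intro p hp; simpa using hP p hp
    refine this.trans (le_of_eq ?_)
    simp only [← SimpleGraph.card_neighborFinset_eq_degree, SimpleGraph.neighborFinset_eq_filter]
    simp only [card_filter, Fintype.sum_prod_type]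
  rw [G.sum_degrees_eq_twice_card_edges] at h3
  calc r * #P ≤ r * (2 * #G.edgeFinset) := by gcongr
    _ ≤ 2 * r * #(SimpleGraph.turanGraph (Fintype.card V) r).edgeFinset := by
        rw [show r * (2 * #G.edgeFinset) = 2 * r * #G.edgeFinset by ring]; gcongr
    _ ≤ _ := h2

end TripleSystems

section Shadow

variable {V : Type*} [Fintype V] {E : V → V → V → Prop}

open scoped Classical in
lemma IsTripleSystem.sum_light_link_le (hE : IsTripleSystem E) :
    ∑ v, #{p ∈ link E v | p ∉ heavy E} ≤ 2 * Fintype.card V ^ 2 := by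
  have h1 : ∑ v, #{p ∈ link E v | p ∉ heavy E} =
      ∑ p : V × V, if p ∉ heavy E then #(nbr E p.1 p.2) else 0 := by
    simp only [link, nbr, filter_filter, card_filter]
    rw [sum_comm]
    refine sum_congr rfl fun p _ => ?_
    by_cases hp : p ∈ heavy E
    · simp [hp]
    · simp only [hp, not_false_eq_true, and_true, if_true]
      refine sum_congr rfl fun v _ => ?_
      congr 1
      exact propext ⟨hE.rot, fun h => hE.rot (hE.rot h)⟩
  rw [h1]
  calc _ ≤ ∑ p : V × V, 2 := by
        refine sum_le_sum fun p _ => ?_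
        by_cases hp : p ∈ heavy E
        · simp [hp]
        · simp only [hp, not_false_eq_true, if_true]
          simp only [mem_heavy] at hp; omega
    _ = 2 * Fintype.card V ^ 2 := by simp; ring

open scoped Classical in
/-- The vertices whose link contains many pairs of small codegree. -/
noncomputable def lightVertices (E : V → V → V → Prop) (η : ℝ) : Finset V :=
  {v | η * (Fintype.card V : ℝ) ^ 2 < #{p ∈ link E v | p ∉ heavy E}}

open scoped Classical in
lemma IsTripleSystem.card_lightVertices_le (hE : IsTripleSystem E) {η : ℝ} (hη : 0 < η) :
    (#(lightVertices E η) : ℝ) ≤ 2 / η := by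
  rcases (Fintype.card V).eq_zero_or_pos with h0 | h0
  · have : IsEmpty V := Fintype.card_eq_zero_iff.mp h0
    rw [Finset.eq_empty_of_isEmpty (lightVertices E η)]
    simp only [card_empty, Nat.cast_zero]; positivity
  have hn : (0 : ℝ) < (Fintype.card V : ℝ) ^ 2 := by positivity
  have h1 : (#(lightVertices E η) : ℝ) * (η * (Fintype.card V : ℝ) ^ 2) ≤
      2 * (Fintype.card V : ℝ) ^ 2 := by
    calc _ = ∑ v ∈ lightVertices E η, η * (Fintype.card V : ℝ) ^ 2 := by simp
      _ ≤ ∑ v ∈ lightVertices E η, (#{p ∈ link E v | p ∉ heavy E} : ℝ) := by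
          refine sum_le_sum fun v hv => ?_
          simp only [lightVertices, mem_filter, mem_univ, true_and] at hv
          exact hv.le
      _ ≤ ∑ v, (#{p ∈ link E v | p ∉ heavy E} : ℝ) :=
          sum_le_sum_of_subset_of_nonneg (subset_univ _) (fun _ _ _ => by positivity)
      _ ≤ 2 * (Fintype.card V : ℝ) ^ 2 := by exact_mod_cast hE.sum_light_link_le
  rw [le_div_iff₀ hη]
  nlinarith

/-- The graph of pairs of codegree at least three that avoid a given set of vertices. -/
def heavyGraph (hE : IsTripleSystem E) (Y : Finset V) : SimpleGraph V where
  Adj x y := 3 ≤ #(nbr E x y) ∧ x ∉ Y ∧ y ∉ Y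
  symm := ⟨fun x y h => ⟨hE.nbr_comm x y ▸ h.1, h.2.2, h.2.1⟩⟩
  loopless := ⟨fun x h => by
    obtain ⟨z, hz⟩ := card_pos.mp (lt_of_lt_of_le (by norm_num) h.1)
    exact hE.ne (mem_nbr.mp hz) rfl⟩

/-- The links of the vertices of a clique in the graph of heavy pairs are disjoint. -/
lemma F5Free.pairwiseDisjoint_link (hE : IsTripleSystem E) (hF : F5Free E) {Y s : Finset V}
    (hs : (heavyGraph hE Y).IsClique s) : (s : Set V).PairwiseDisjoint (link E) :=
  fun _ hx _ hy hxy => hF.disjoint_link hE (hs hx hy hxy).1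

/-- In an `F_5`-free triple system of large minimum degree, few pairs are heavy. -/
lemma F5Free.card_heavy_le (hE : IsTripleSystem E) (hF : F5Free E) {X : Finset V}
    (hX : ∀ x ∈ X, ∀ y z, ¬ E x y z)
    (hdeg : ∀ v ∉ X, (2 / 9 - 1 / 10000) * (Fintype.card V : ℝ) ^ 2 ≤ #(link E v))
    (hn : 1000000000 ≤ Fintype.card V) :
    (#(heavy E) : ℝ) ≤ (2 / 3 + 1 / 10000) * (Fintype.card V : ℝ) ^ 2 := by
  classical
  set n := Fintype.card V with hndef
  have hnR : (1000000000 : ℝ) ≤ n := by exact_mod_cast hn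
  set Y := lightVertices E (1 / 10000) with hY
  have hYc : (#Y : ℝ) ≤ 20000 :=
    (hE.card_lightVertices_le (by norm_num)).trans (by norm_num)
  have hYn : (#Y : ℝ) * n ≤ 1 / 20000 * (n : ℝ) ^ 2 := by nlinarith
  have hT : (#(touching Y) : ℝ) ≤ 1 / 10000 * (n : ℝ) ^ 2 := by
    have : (#(touching Y) : ℝ) ≤ 2 * #Y * n := by exact_mod_cast card_touching_le Y
    nlinarith
  set G := heavyGraph hE Y with hG
  have hXs : ∀ {s : Finset V}, G.IsClique s → 2 ≤ #s → ∀ v ∈ s, v ∉ X := by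
    intro s hs h2 v hv hvX
    obtain ⟨w, hw, hwv⟩ := exists_mem_ne h2 v
    obtain ⟨z, hz⟩ := card_pos.mp (lt_of_lt_of_le (by norm_num) (hs hv hw hwv.symm).1)
    exact hX v hvX _ _ (mem_nbr.mp hz)
  have hK5 : G.CliqueFree 5 := by
    intro s hs
    have h1 : #(s.biUnion (link E)) ≤ n ^ 2 := by
      refine (card_le_univ _).trans (le_of_eq ?_)
      simp [hndef, sq]
    rw [card_biUnion (hF.pairwiseDisjoint_link hE hs.1)] at h1
    have h2 : (∑ v ∈ s, #(link E v) : ℝ) ≤ (n : ℝ) ^ 2 := by exact_mod_cast h1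
    have h3 : ∑ v ∈ s, (2 / 9 - 1 / 10000) * (n : ℝ) ^ 2 ≤ ∑ v ∈ s, (#(link E v) : ℝ) :=
      sum_le_sum fun v hv => hdeg v (hXs hs.1 (by rw [hs.2]; norm_num) v hv)
    rw [sum_const, hs.2] at h3
    simp only [nsmul_eq_mul] at h3
    push_cast at h3
    nlinarith
  set P : Finset (V × V) := {p | G.Adj p.1 p.2} with hP
  have hP5 : (4 : ℝ) * #P ≤ 3 * (n : ℝ) ^ 2 := by
    exact_mod_cast turan_ordered_pairs G (r := 4) (by norm_num) hK5 P (by simp [hP])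
  have hsub : heavy E ⊆ P ∪ touching Y := by
    intro p hp
    simp only [mem_heavy] at hp
    simp only [hP, mem_union, mem_filter, mem_univ, true_and, mem_touching, hG, heavyGraph]
    tauto
  have hK4 : G.CliqueFree 4 := by
    intro s hs
    have h1 : s.biUnion (fun v => {p ∈ link E v | p ∈ heavy E}) ⊆ P ∪ touching Y := by
      intro p hp
      simp only [mem_biUnion, mem_filter] at hp
      obtain ⟨v, _, _, hp⟩ := hp
      exact hsub hp
    have h2 : (#(s.biUnion (fun v => {p ∈ link E v | p ∈ heavy E})) : ℝ) ≤
        #P + #(touching Y) := by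
      exact_mod_cast (card_le_card h1).trans (card_union_le _ _)
    rw [card_biUnion] at h2
    · have h3 : ∀ v ∈ s, (2 / 9 - 2 / 10000) * (n : ℝ) ^ 2 ≤
          #{p ∈ link E v | p ∈ heavy E} := by
        intro v hv
        have h4 := hdeg v (hXs hs.1 (by rw [hs.2]; norm_num) v hv)
        have h5 : v ∉ Y := by
          obtain ⟨w, hw, hwv⟩ := exists_mem_ne (show 1 < #s by rw [hs.2]; norm_num) v
          exact (hs.1 hv hw hwv.symm).2.1
        simp only [hY, lightVertices, mem_filter, mem_univ, true_and, not_lt] at h5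
        have h6 : (#{p ∈ link E v | p ∈ heavy E} : ℝ) + #{p ∈ link E v | p ∉ heavy E} =
            #(link E v) := by
          exact_mod_cast card_filter_add_card_filter_not _
        linarith
      have h7 := sum_le_sum h3
      rw [sum_const, hs.2] at h7
      simp only [nsmul_eq_mul] at h7
      push_cast at h2 h7
      nlinarith
    · intro x hx y hy hxy
      exact (hF.pairwiseDisjoint_link hE hs.1 hx hy hxy).mono (filter_subset _ _)
        (filter_subset _ _)
  have hP4 : (3 : ℝ) * #P ≤ 2 * (n : ℝ) ^ 2 := by
    exact_mod_cast turan_ordered_pairs G (r := 3) (by norm_num) hK4 P (by simp [hP])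
  have h8 : (#(heavy E) : ℝ) ≤ #P + #(touching Y) := by
    exact_mod_cast (card_le_card hsub).trans (card_union_le _ _)
  linarith

end Shadow

section BaseEdge

variable {V : Type*} [Fintype V] {E : V → V → V → Prop}

open scoped Classical in
/-- The ordered edges all of whose pairs are heavy. -/
noncomputable def heavyTriples (E : V → V → V → Prop) : Finset (V × V × V) :=
  {q | E q.1 q.2.1 q.2.2 ∧ (q.1, q.2.1) ∈ heavy E ∧ (q.2.1, q.2.2) ∈ heavy E ∧
    (q.2.2, q.1) ∈ heavy E}

lemma IsTripleSystem.sum_heavyTriples_rot (hE : IsTripleSystem E) (f : V → V → ℝ) :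
    ∑ q ∈ heavyTriples E, f q.2.1 q.2.2 = ∑ q ∈ heavyTriples E, f q.1 q.2.1 := by
  refine sum_nbij' (fun q => (q.2.1, q.2.2, q.1)) (fun q => (q.2.2, q.1, q.2.1)) ?_ ?_ ?_ ?_ ?_
  · rintro ⟨x, y, z⟩ h
    simp only [heavyTriples, mem_filter, mem_univ, true_and] at h ⊢
    exact ⟨hE.rot h.1, h.2.2.1, h.2.2.2, h.2.1⟩
  · rintro ⟨x, y, z⟩ h
    simp only [heavyTriples, mem_filter, mem_univ, true_and] at h ⊢
    exact ⟨hE.rot (hE.rot h.1), h.2.2.2, h.2.1, h.2.2.1⟩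
  · simp
  · simp
  · simp

open scoped Classical in
lemma IsTripleSystem.sum_sq_heavy_le (hE : IsTripleSystem E) :
    ∑ p ∈ heavy E, (#(nbr E p.1 p.2) : ℝ) ^ 2 ≤
      ∑ q ∈ heavyTriples E, (#(nbr E q.1 q.2.1) : ℝ) + 4 * (Fintype.card V : ℝ) ^ 3 := by
  set n := Fintype.card V with hn
  have hcd : ∀ x y, (#(nbr E x y) : ℝ) ≤ n := fun x y => by exact_mod_cast card_le_univ _
  set D : Finset (V × V × V) := {q | E q.1 q.2.1 q.2.2 ∧ (q.1, q.2.1) ∈ heavy E} with hD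
  set L1 : Finset (V × V × V) := {q | E q.1 q.2.1 q.2.2 ∧ (q.2.1, q.2.2) ∉ heavy E} with hL1
  set L2 : Finset (V × V × V) := {q | E q.1 q.2.1 q.2.2 ∧ (q.2.2, q.1) ∉ heavy E} with hL2
  have h1 : ∑ p ∈ heavy E, (#(nbr E p.1 p.2) : ℝ) ^ 2 = ∑ q ∈ D, (#(nbr E q.1 q.2.1) : ℝ) := by
    have h2 : ∑ p ∈ heavy E, (#(nbr E p.1 p.2) : ℝ) ^ 2 =
        ∑ p : V × V, if p ∈ heavy E then (#(nbr E p.1 p.2) : ℝ) ^ 2 else 0 := by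
      rw [← sum_filter, filter_mem_eq_inter, univ_inter]
    rw [h2, hD, sum_filter, Fintype.sum_prod_type, Fintype.sum_prod_type]
    refine sum_congr rfl fun x _ => ?_
    rw [Fintype.sum_prod_type]
    refine sum_congr rfl fun y _ => ?_
    by_cases hxy : (x, y) ∈ heavy E
    · simp only [hxy, and_true, if_true]
      rw [← sum_filter, sum_const, nsmul_eq_mul, sq]
      rfl
    · simp [hxy]
  have hL1c : #L1 ≤ 2 * n ^ 2 := by
    refine le_trans (le_of_eq ?_) hE.sum_light_link_le
    rw [hL1, card_filter, Fintype.sum_prod_type]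
    refine sum_congr rfl fun v _ => ?_
    rw [link, filter_filter, card_filter]
  have hL2c : #L2 ≤ 2 * n ^ 2 := by
    refine le_trans ?_ hL1c
    refine card_le_card_of_injOn (fun q => (q.2.1, q.2.2, q.1)) ?_ ?_
    · rintro ⟨x, y, z⟩ h
      simp only [hL1, hL2, coe_filter, Set.mem_ofPred_eq, mem_univ, true_and] at h ⊢
      exact ⟨hE.rot h.1, h.2⟩
    · rintro ⟨x, y, z⟩ _ ⟨x', y', z'⟩ _ h
      simp only [Prod.mk.injEq] at h ⊢
      tauto
  have hsub : D ⊆ heavyTriples E ∪ (L1 ∪ L2) := by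
    rintro ⟨x, y, z⟩ h
    simp only [hL1, hL2, hD, heavyTriples, mem_union, mem_filter, mem_univ, true_and] at h ⊢
    tauto
  rw [h1]
  calc _ ≤ ∑ q ∈ heavyTriples E ∪ (L1 ∪ L2), (#(nbr E q.1 q.2.1) : ℝ) :=
        sum_le_sum_of_subset_of_nonneg hsub (fun _ _ _ => by positivity)
    _ ≤ ∑ q ∈ heavyTriples E, (#(nbr E q.1 q.2.1) : ℝ) +
          ∑ q ∈ L1 ∪ L2, (#(nbr E q.1 q.2.1) : ℝ) := by
        rw [← sum_union_inter]
        have : 0 ≤ ∑ q ∈ heavyTriples E ∩ (L1 ∪ L2), (#(nbr E q.1 q.2.1) : ℝ) :=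
          sum_nonneg fun _ _ => by positivity
        linarith
    _ ≤ ∑ q ∈ heavyTriples E, (#(nbr E q.1 q.2.1) : ℝ) + ∑ q ∈ L1 ∪ L2, (n : ℝ) := by
        gcongr with q _; exact card_le_univ _
    _ ≤ _ := by
        have : (#(L1 ∪ L2) : ℝ) ≤ 4 * (n : ℝ) ^ 2 := by
          have := (card_union_le L1 L2).trans (add_le_add hL1c hL2c)
          have h' : #(L1 ∪ L2) ≤ 4 * n ^ 2 := by omega
          exact_mod_cast h'
        rw [sum_const, nsmul_eq_mul]
        have hn0 : (0 : ℝ) ≤ n := by positivity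
        nlinarith

/-- The numerical contradiction behind `F5Free.exists_heavyTriple`. -/
lemma codegree_numerics {n T S M W K h : ℝ} (hn : 1000000000 ≤ n)
    (hT : (2 / 9 - 2 / 10000) * n ^ 3 ≤ T) (hW : T - 2 * n ^ 2 ≤ W) (hCS : W ^ 2 ≤ h * S)
    (hh : h ≤ (2 / 3 + 1 / 10000) * n ^ 2) (hS : 0 ≤ S) (hSM : S ≤ M + 4 * n ^ 3)
    (hM : M + M + M ≤ K * ((1 - 1 / 500) * n)) (hK : K ≤ T) : False := by
  have hn2 : 1000000000 * n ^ 2 ≤ n ^ 3 := by nlinarith [sq_nonneg n]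
  have hn0 : 0 < n ^ 3 := by positivity
  have hn20 : 0 < n ^ 2 := by positivity
  obtain ⟨U, hU⟩ : ∃ U, U = T - 2 * n ^ 2 := ⟨_, rfl⟩
  have hU1 : (2 / 9 - 3 / 10000) * n ^ 3 ≤ U := by linarith
  have hU0 : 0 ≤ U := by linarith
  have h5 : U ^ 2 ≤ W ^ 2 := by rw [hU] at hU0 ⊢; gcongr
  have h6 : h * S ≤ (2 / 3 + 1 / 10000) * n ^ 2 * S := by gcongr
  have h7 : M ≤ (U + 2 * n ^ 2) * ((1 - 1 / 500) * n) / 3 := by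
    have : K * ((1 - 1 / 500) * n) ≤ T * ((1 - 1 / 500) * n) :=
      mul_le_mul_of_nonneg_right hK (by linarith)
    have hTU : T = U + 2 * n ^ 2 := by rw [hU]; ring
    rw [hTU] at this
    linarith
  have h8 : (2 / 3 + 1 / 10000) * n ^ 2 * S ≤ (2 / 3 + 1 / 10000) * n ^ 2 *
      ((U + 2 * n ^ 2) * ((1 - 1 / 500) * n) / 3 + 4 * n ^ 3) :=
    mul_le_mul_of_nonneg_left (by linarith) (by linarith)
  have h9 : U * ((2 / 9 - 3 / 10000) * n ^ 3) ≤ U ^ 2 := by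
    rw [sq]; exact mul_le_mul_of_nonneg_left hU1 hU0
  have h10 : n ^ 3 * (U * (2 / 9 - 3 / 10000)) ≤ n ^ 3 * ((2 / 3 + 1 / 10000) *
      ((U + 2 * n ^ 2) * (1 - 1 / 500) / 3 + 4 * n ^ 2)) := by
    calc _ = U * ((2 / 9 - 3 / 10000) * n ^ 3) := by ring
      _ ≤ _ := h9.trans (h5.trans (hCS.trans (h6.trans h8)))
      _ = _ := by ring
  have h11 := le_of_mul_le_mul_left h10 hn0
  linarith

open scoped Classical in
/-- In an `F_5`-free triple system of large minimum degree, some edge has codegree sum close to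
the number of vertices. -/
lemma F5Free.exists_heavyTriple (hE : IsTripleSystem E) (hF : F5Free E) {X : Finset V}
    (hX : ∀ x ∈ X, ∀ y z, ¬ E x y z) (hXc : 10000 * #X ≤ Fintype.card V)
    (hdeg : ∀ v ∉ X, (2 / 9 - 1 / 10000) * (Fintype.card V : ℝ) ^ 2 ≤ #(link E v))
    (hn : 1000000000 ≤ Fintype.card V) :
    ∃ q ∈ heavyTriples E, (1 - 1 / 500) * (Fintype.card V : ℝ) ≤
      (#(nbr E q.1 q.2.1) : ℝ) + #(nbr E q.2.1 q.2.2) + #(nbr E q.2.2 q.1) := by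
  set n := Fintype.card V with hndef
  have hnR : (1000000000 : ℝ) ≤ n := by exact_mod_cast hn
  have hXR : 10000 * (#X : ℝ) ≤ n := by exact_mod_cast hXc
  have hH := hF.card_heavy_le hE hX hdeg hn
  set T : ℝ := ∑ p : V × V, (#(nbr E p.1 p.2) : ℝ) with hT
  have hT1 : (2 / 9 - 2 / 10000) * (n : ℝ) ^ 3 ≤ T := by
    have : T = ∑ v, (#(link E v) : ℝ) := by
      rw [hT, Fintype.sum_prod_type]
      refine sum_congr rfl fun v _ => ?_
      rw [IsTripleSystem.card_link]; push_cast; rfl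
    rw [this]
    calc _ ≤ ((n : ℝ) - #X) * ((2 / 9 - 1 / 10000) * (n : ℝ) ^ 2) := by nlinarith [sq_nonneg (n : ℝ)]
      _ = ∑ v ∈ Xᶜ, (2 / 9 - 1 / 10000) * (n : ℝ) ^ 2 := by
          rw [sum_const, card_compl, nsmul_eq_mul, Nat.cast_sub (card_le_univ _)]
      _ ≤ ∑ v ∈ Xᶜ, (#(link E v) : ℝ) := sum_le_sum fun v hv => hdeg v (by simpa using hv)
      _ ≤ _ := sum_le_sum_of_subset_of_nonneg (subset_univ _) (fun _ _ _ => by positivity)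
  have hT2 : T - 2 * (n : ℝ) ^ 2 ≤ ∑ p ∈ heavy E, (#(nbr E p.1 p.2) : ℝ) := by
    rw [hT, ← sum_filter_add_sum_filter_not univ (· ∈ heavy E)]
    have h1 : ∑ p with p ∉ heavy E, (#(nbr E p.1 p.2) : ℝ) ≤ ∑ p : V × V with p ∉ heavy E, 2 := by
      refine sum_le_sum fun p hp => ?_
      simp only [mem_filter, mem_univ, mem_heavy, true_and, not_le] at hp
      exact_mod_cast Nat.le_of_lt_succ hp
    have h2 : ∑ p : V × V with p ∉ heavy E, (2 : ℝ) ≤ ∑ p : V × V, 2 :=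
      sum_le_sum_of_subset_of_nonneg (subset_univ _) (fun _ _ _ => by positivity)
    have h3 : ∑ p : V × V, (2 : ℝ) = 2 * (n : ℝ) ^ 2 := by simp [hndef]; ring
    rw [filter_mem_eq_inter, univ_inter]
    linarith
  set S : ℝ := ∑ p ∈ heavy E, (#(nbr E p.1 p.2) : ℝ) ^ 2 with hS
  have hCS : (∑ p ∈ heavy E, (#(nbr E p.1 p.2) : ℝ)) ^ 2 ≤ #(heavy E) * S :=
    sq_sum_le_card_mul_sum_sq
  have hS0 : 0 ≤ S := sum_nonneg fun _ _ => by positivity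
  have hST := hE.sum_sq_heavy_le
  rw [← hS, ← hndef] at hST
  by_contra! hcon
  have h1 : ∑ q ∈ heavyTriples E, ((#(nbr E q.1 q.2.1) : ℝ) + #(nbr E q.2.1 q.2.2) +
      #(nbr E q.2.2 q.1)) ≤ ∑ q ∈ heavyTriples E, (1 - 1 / 500) * (n : ℝ) :=
    sum_le_sum fun q hq => (hcon q hq).le
  have h2 := hE.sum_heavyTriples_rot (fun x y => (#(nbr E x y) : ℝ))
  have h3 : ∑ q ∈ heavyTriples E, (#(nbr E q.2.2 q.1) : ℝ) =
      ∑ q ∈ heavyTriples E, (#(nbr E q.1 q.2.1) : ℝ) := by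
    rw [← h2]
    refine sum_nbij' (fun q => (q.2.1, q.2.2, q.1)) (fun q => (q.2.2, q.1, q.2.1)) ?_ ?_ ?_ ?_ ?_
    · rintro ⟨x, y, z⟩ h
      simp only [heavyTriples, mem_filter, mem_univ, true_and] at h ⊢
      exact ⟨hE.rot h.1, h.2.2.1, h.2.2.2, h.2.1⟩
    · rintro ⟨x, y, z⟩ h
      simp only [heavyTriples, mem_filter, mem_univ, true_and] at h ⊢
      exact ⟨hE.rot (hE.rot h.1), h.2.2.2, h.2.1, h.2.2.1⟩
    · simp
    · simp
    · simp
  rw [sum_add_distrib, sum_add_distrib, h2, h3, sum_const, nsmul_eq_mul] at h1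
  have h4 : (#(heavyTriples E) : ℝ) ≤ T := by
    have : T = #({q : V × V × V | E q.1 q.2.1 q.2.2} : Finset _) := by
      rw [card_filter, Fintype.sum_prod_type, hT, Fintype.sum_prod_type]
      push_cast
      refine sum_congr rfl fun x _ => ?_
      rw [Fintype.sum_prod_type]
      refine sum_congr rfl fun y _ => ?_
      rw [nbr, card_filter]; push_cast; rfl
    rw [this]
    norm_cast
    refine card_le_card fun q hq => ?_
    simp only [heavyTriples, mem_filter, mem_univ, true_and] at hq ⊢
    exact hq.1
  exact codegree_numerics hnR hT1 hT2 hCS hH hS0 hST h1 h4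

open scoped Classical in
/-- In an `F_5`-free triple system of large minimum degree, there are three disjoint sets covering
almost all vertices, none of which contains a heavy pair. -/
lemma F5Free.exists_parts (hE : IsTripleSystem E) (hF : F5Free E) {X : Finset V}
    (hX : ∀ x ∈ X, ∀ y z, ¬ E x y z) (hXc : 10000 * #X ≤ Fintype.card V)
    (hdeg : ∀ v ∉ X, (2 / 9 - 1 / 10000) * (Fintype.card V : ℝ) ^ 2 ≤ #(link E v))
    (hn : 1000000000 ≤ Fintype.card V) :
    ∃ P : Fin 3 → Finset V, (∀ i j, i ≠ j → Disjoint (P i) (P j)) ∧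
      (1 - 1 / 500) * (Fintype.card V : ℝ) ≤ ∑ i, (#(P i) : ℝ) ∧
      ∀ i, ∀ u ∈ P i, ∀ v ∈ P i, #(nbr E u v) < 3 := by
  obtain ⟨q, hq, hqw⟩ := hF.exists_heavyTriple hE hX hXc hdeg hn
  obtain ⟨x, y, z⟩ := q
  simp only [heavyTriples, mem_filter, mem_univ, true_and, mem_heavy] at hq
  obtain ⟨hxyz, hxy, hyz, hzx⟩ := hq
  have hdis : ∀ {x y z : V}, 3 ≤ #(nbr E y z) → Disjoint (nbr E x y) (nbr E z x) := by
    intro x y z h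
    rw [disjoint_left]
    intro w h1 h2
    simp only [mem_nbr] at h1 h2
    exact hF.not_common h (hE.swap' h1) (hE.rot h2)
  have hind : ∀ {x y : V}, ∀ u ∈ nbr E x y, ∀ v ∈ nbr E x y, #(nbr E u v) < 3 := by
    intro x y u hu v hv
    by_contra! h
    exact hF.not_common h (mem_nbr.mp hu) (mem_nbr.mp hv)
  refine ⟨![nbr E x y, nbr E y z, nbr E z x], ?_, ?_, ?_⟩
  · intro i j hij
    fin_cases i <;> fin_cases j <;> first | exact absurd rfl hij | skip
    · exact (hdis hzx).symm
    · exact hdis hyz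
    · exact hdis hzx
    · exact (hdis hxy).symm
    · exact (hdis hyz).symm
    · exact hdis hxy
  · simpa [Fin.sum_univ_three] using hqw
  · intro i
    fin_cases i <;> exact hind

end BaseEdge

section Parts

variable {V : Type*} [Fintype V] {E : V → V → V → Prop}

open scoped Classical in
/-- The pairs in the link of `v` that go between the two parts other than part `i`. -/
noncomputable def cross (E : V → V → V → Prop) (P : Fin 3 → Finset V) (i : Fin 3) (v : V) :
    Finset (V × V) :=
  {p ∈ P (i + 1) ×ˢ P (i + 2) | E v p.1 p.2}

open scoped Classical in
/-- The pairs in the link of `v` inside some part. -/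
noncomputable def innerPairs (E : V → V → V → Prop) (P : Fin 3 → Finset V) (v : V) :
    Finset (V × V) :=
  {p ∈ link E v | ∃ i, p.1 ∈ P i ∧ p.2 ∈ P i}

omit [Fintype V] in
lemma mem_cross {P : Fin 3 → Finset V} {i : Fin 3} {v : V} {p : V × V} :
    p ∈ cross E P i v ↔ (p.1 ∈ P (i + 1) ∧ p.2 ∈ P (i + 2)) ∧ E v p.1 p.2 := by
  simp [cross]

lemma mem_innerPairs {P : Fin 3 → Finset V} {v : V} {p : V × V} :
    p ∈ innerPairs E P v ↔ E v p.1 p.2 ∧ ∃ i, p.1 ∈ P i ∧ p.2 ∈ P i := by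
  simp [innerPairs]

omit [Fintype V] in
lemma cross_subset {P : Fin 3 → Finset V} {i : Fin 3} {v : V} :
    cross E P i v ⊆ P (i + 1) ×ˢ P (i + 2) := by
  intro p hp
  simpa using (mem_cross.mp hp).1

omit [Fintype V] in
lemma card_cross_le {P : Fin 3 → Finset V} {i : Fin 3} {v : V} :
    #(cross E P i v) ≤ #(P (i + 1)) * #(P (i + 2)) :=
  (card_le_card cross_subset).trans (card_product _ _).le

lemma IsTripleSystem.card_link_le (hE : IsTripleSystem E) {P : Fin 3 → Finset V} {R : Finset V}
    (hR : ∀ v ∉ R, ∃ i, v ∈ P i) (v : V) :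
    #(link E v) ≤ 2 * (#(cross E P 0 v) + #(cross E P 1 v) + #(cross E P 2 v)) +
      #(innerPairs E P v) + 2 * #R * Fintype.card V := by
  classical
  set Q := cross E P 0 v ∪ cross E P 1 v ∪ cross E P 2 v with hQ
  have hQc : #Q ≤ #(cross E P 0 v) + #(cross E P 1 v) + #(cross E P 2 v) :=
    (card_union_le _ _).trans (by gcongr; exact card_union_le _ _)
  have hsub : link E v ⊆ Q ∪ Q.image Prod.swap ∪ innerPairs E P v ∪ touching R := by
    rintro ⟨x, y⟩ hp
    have hxy : E v x y := mem_link.mp hp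
    by_cases hx : x ∈ R
    · simp [hx]
    by_cases hy : y ∈ R
    · simp [hy]
    obtain ⟨i, hi⟩ := hR x hx
    obtain ⟨j, hj⟩ := hR y hy
    by_cases hij : i = j
    · subst hij
      exact mem_union_left _ (mem_union_right _ (mem_innerPairs.mpr ⟨hxy, i, hi, hj⟩))
    · refine mem_union_left _ (mem_union_left _ ?_)
      have hyx : E v y x := hE.swap' hxy
      simp only [hQ, mem_union, mem_image, Prod.exists, Prod.swap_prod_mk, Prod.mk.injEq,
        mem_cross]
      fin_cases i <;> fin_cases j <;> first | exact absurd rfl hij | skip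
      · exact Or.inl (Or.inr ⟨⟨hi, hj⟩, hxy⟩)
      · exact Or.inr ⟨y, x, Or.inl (Or.inr ⟨⟨hj, hi⟩, hyx⟩), rfl, rfl⟩
      · exact Or.inr ⟨y, x, Or.inr ⟨⟨hj, hi⟩, hyx⟩, rfl, rfl⟩
      · exact Or.inl (Or.inl (Or.inl ⟨⟨hi, hj⟩, hxy⟩))
      · exact Or.inl (Or.inl (Or.inr ⟨⟨hi, hj⟩, hxy⟩))
      · exact Or.inr ⟨y, x, Or.inl (Or.inl ⟨⟨hj, hi⟩, hyx⟩), rfl, rfl⟩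
  have h1 := card_le_card hsub
  have h2 := card_union_le (Q ∪ Q.image Prod.swap ∪ innerPairs E P v) (touching R)
  have h3 := card_union_le (Q ∪ Q.image Prod.swap) (innerPairs E P v)
  have h4 := card_union_le Q (Q.image Prod.swap)
  have h5 : #(Q.image Prod.swap) ≤ #Q := card_image_le
  have h6 := card_touching_le R
  omega

lemma IsTripleSystem.card_cross_le_of_light (hE : IsTripleSystem E) {P : Fin 3 → Finset V}
    {Y : Finset V} {i j : Fin 3} (hij : i ≠ j) {v : V}
    (h : ∀ u ∈ P i, u ∉ Y → #(nbr E v u) < 3) :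
    #(cross E P j v) ≤ 2 * Fintype.card V + #Y * Fintype.card V := by
  classical
  have h1 : #({p : V × V | p.1 ∈ P i ∧ E v p.1 p.2} : Finset _) ≤
      2 * Fintype.card V + #Y * Fintype.card V := by
    rw [card_filter, Fintype.sum_prod_type]
    calc _ ≤ ∑ u : V, (2 + if u ∈ Y then Fintype.card V else 0) := by
          refine sum_le_sum fun u _ => ?_
          rw [← card_filter]
          by_cases hu : u ∈ P i
          · by_cases hY : u ∈ Y
            · simp only [hY, if_true]
              exact (card_le_univ _).trans (by omega)
            · have := h u hu hY
              simp only [nbr] at this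
              simp only [hu, true_and, hY, if_false]
              omega
          · simp [hu]
      _ = _ := by simp [sum_add_distrib]; ring
  refine le_trans ?_ h1
  have hcase : i = j + 1 ∨ i = j + 2 := by
    clear h h1; revert hij; revert i j; decide
  rcases hcase with rfl | rfl
  · refine card_le_card fun p hp => ?_
    rw [mem_cross] at hp
    simpa using ⟨hp.1.1, hp.2⟩
  · refine card_le_card_of_injOn Prod.swap (fun p hp => ?_) Prod.swap_injective.injOn
    rw [mem_coe, mem_cross] at hp
    simpa using ⟨hp.1.2, hE.swap' hp.2⟩

/-- Two large subsets of a set intersect outside a small set. -/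
lemma exists_mem_inter_of_card {α : Type*} {Q S₁ S₂ T : Finset α}
    (h₁ : S₁ ⊆ Q) (h₂ : S₂ ⊆ Q) (h : #Q + #T < #S₁ + #S₂) : ∃ p ∈ S₁, p ∈ S₂ ∧ p ∉ T := by
  classical
  have h3 := card_union_add_card_inter S₁ S₂
  have h4 := card_le_card (union_subset h₁ h₂)
  obtain ⟨p, hp, hpT⟩ := exists_mem_notMem_of_card_lt_card (show #T < #(S₁ ∩ S₂) by omega)
  exact ⟨p, (mem_inter.mp hp).1, (mem_inter.mp hp).2, hpT⟩

/-- If the product of any two of three numbers of bounded sum is large, it cannot be too large. -/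
lemma mul_le_of_three {n x y z : ℝ} (hn : 0 ≤ n) (hx : 0 ≤ x) (hy : 0 ≤ y) (hz : 0 ≤ z)
    (hs : x + y + z ≤ n) (hxy : 0.1088 * n ^ 2 ≤ x * y) (hyz : 0.1088 * n ^ 2 ≤ y * z)
    (hzx : 0.1088 * n ^ 2 ≤ z * x) :
    x ≤ 0.3408 * n ∧ y ≤ 0.3408 * n ∧ z ≤ 0.3408 * n := by
  have key : ∀ {x y z : ℝ}, 0 ≤ x → 0 ≤ y → x + y + z ≤ n → 0.1088 * n ^ 2 ≤ x * y →
      z ≤ 0.3408 * n := by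
    intro x y z hx hy hs hxy
    have h1 : (0.6592 * n) ^ 2 ≤ (x + y) ^ 2 := by nlinarith [sq_nonneg (x - y)]
    have h2 : 0.6592 * n ≤ x + y := by
      exact (pow_le_pow_iff_left₀ (by positivity) (by positivity) two_ne_zero).mp h1
    linarith
  exact ⟨key hy hz (by linarith) hyz, key hz hx (by linarith) hzx, key hx hy hs hxy⟩

end Parts

section Stability

variable {V : Type*} [Fintype V] {E : V → V → V → Prop}

lemma sum_card_le_of_disjoint {P : Fin 3 → Finset V}
    (hP : ∀ i j, i ≠ j → Disjoint (P i) (P j)) : #(P 0) + #(P 1) + #(P 2) ≤ Fintype.card V := by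
  classical
  have := card_le_univ (univ.biUnion P)
  rw [card_biUnion (fun i _ j _ h => hP i j h), Fin.sum_univ_three] at this
  exact this

lemma card_not_mem_le {P : Fin 3 → Finset V} [DecidableEq V]
    (hP : ∀ i j, i ≠ j → Disjoint (P i) (P j)) :
    #(univ.biUnion P)ᶜ + (#(P 0) + #(P 1) + #(P 2)) = Fintype.card V := by
  rw [← card_compl_add_card (univ.biUnion P), card_biUnion (fun i _ j _ h => hP i j h),
    Fin.sum_univ_three]

/-- Products of part sizes are controlled when every part has a vertex of large cross degree. -/
lemma mul_card_le_of_cross {P : Fin 3 → Finset V}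
    (hP : ∀ i j, i ≠ j → Disjoint (P i) (P j))
    (h : ∀ i, 0.1088 * (Fintype.card V : ℝ) ^ 2 ≤ #(P (i + 1)) * #(P (i + 2))) :
    ∀ i, (#(P i) : ℝ) ≤ 0.3408 * Fintype.card V := by
  have h0 := h 0
  have h1 := h 1
  have h2 := h 2
  have hs : (#(P 0) : ℝ) + #(P 1) + #(P 2) ≤ Fintype.card V := by
    exact_mod_cast sum_card_le_of_disjoint hP
  have := mul_le_of_three (by positivity) (by positivity) (by positivity) (by positivity)
    hs h2 h0 h1
  intro i
  fin_cases i
  exacts [this.1, this.2.1, this.2.2]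

lemma mul_card_le_of_card_le {P : Fin 3 → Finset V}
    (h : ∀ i, (#(P i) : ℝ) ≤ 0.3408 * Fintype.card V) (i j : Fin 3) :
    (#(P i) : ℝ) * #(P j) ≤ 0.117 * (Fintype.card V : ℝ) ^ 2 := by
  calc (#(P i) : ℝ) * #(P j) ≤ (0.3408 * Fintype.card V) * (0.3408 * Fintype.card V) := by
        gcongr <;> exact h _
    _ ≤ _ := by nlinarith [sq_nonneg (Fintype.card V : ℝ)]

/-- In an `F_5`-free triple system of large minimum degree, there are three disjoint sets such that
all but few vertices have a link that is almost complete between two of the sets. -/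
lemma F5Free.exists_typical (hE : IsTripleSystem E) (hF : F5Free E) {X : Finset V}
    (hX : ∀ x ∈ X, ∀ y z, ¬ E x y z) (hXc : 1000000 * #X ≤ Fintype.card V)
    (hdeg : ∀ v ∉ X, (2 / 9 - 1 / 10000) * (Fintype.card V : ℝ) ^ 2 ≤ #(link E v))
    (hn : 10000000000 ≤ Fintype.card V) :
    ∃ (P : Fin 3 → Finset V) (R Y : Finset V), (∀ v ∉ R, ∃ i, v ∈ P i) ∧
      500 * #R ≤ Fintype.card V ∧
      100000 * #Y ≤ Fintype.card V ∧
      (∀ i, (#(P i) : ℝ) ≤ 0.3408 * Fintype.card V) ∧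
      (∀ i, ∀ u ∈ P i, u ∉ Y → 0.1088 * (Fintype.card V : ℝ) ^ 2 ≤ #(cross E P i u)) := by
  classical
  obtain ⟨P, hP, hPs, hPl⟩ := hF.exists_parts hE hX (by omega) hdeg (by omega)
  set n := Fintype.card V with hndef
  have hnR : (10000000000 : ℝ) ≤ n := by exact_mod_cast hn
  have hn2 : (10000000000 : ℝ) * n ≤ (n : ℝ) ^ 2 := by nlinarith
  set Y := lightVertices E (1 / 10000) ∪ X with hY
  have hYc : 100000 * #Y ≤ n := by
    have h1 : (#(lightVertices E (1 / 10000)) : ℝ) ≤ (20000 : ℕ) :=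
      (hE.card_lightVertices_le (by norm_num)).trans (by norm_num)
    have h2 : #(lightVertices E (1 / 10000)) ≤ 20000 := by exact_mod_cast h1
    have h3 : #Y ≤ #(lightVertices E (1 / 10000)) + #X := card_union_le _ _
    omega
  set R := (univ.biUnion P)ᶜ with hRdef
  have hR : ∀ v ∉ R, ∃ i, v ∈ P i := by
    intro v hv; simpa [hRdef] using hv
  have hRc : 500 * #R ≤ n := by
    have h1 := card_not_mem_le hP
    rw [Fin.sum_univ_three] at hPs
    have h2 : (#R : ℝ) + (#(P 0) + #(P 1) + #(P 2)) = n := by exact_mod_cast h1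
    have h3 : (500 : ℝ) * #R ≤ n := by linarith
    exact_mod_cast h3
  have hcross : ∀ i, ∀ u ∈ P i, u ∉ Y → 0.1088 * (n : ℝ) ^ 2 ≤ #(cross E P i u) := by
    intro i u hu huY
    simp only [hY, mem_union, not_or] at huY
    have h1 := hdeg u huY.2
    have h2 : (#(link E u) : ℝ) ≤ 2 * (#(cross E P 0 u) + #(cross E P 1 u) + #(cross E P 2 u)) +
      #(innerPairs E P u) + 2 * #R * n := by exact_mod_cast hE.card_link_le hR u
    have h3 : ∀ j, i ≠ j → (#(cross E P j u) : ℝ) ≤ 2 * n := by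
      intro j hij
      have := hE.card_cross_le_of_light (P := P) (Y := ∅) hij (v := u)
        (fun w hw _ => hPl i u hu w hw)
      simp only [card_empty, zero_mul, add_zero] at this
      exact_mod_cast this
    have h4 : (#(innerPairs E P u) : ℝ) ≤ 1 / 10000 * (n : ℝ) ^ 2 := by
      have h5 := huY.1
      simp only [lightVertices, mem_filter, mem_univ, true_and, not_lt] at h5
      refine le_trans ?_ h5
      norm_cast
      refine card_le_card fun p hp => ?_
      rw [mem_innerPairs] at hp
      obtain ⟨hp, j, hj1, hj2⟩ := hp
      simp only [mem_filter, mem_link, mem_heavy, not_le]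
      exact ⟨hp, hPl j _ hj1 _ hj2⟩
    have h5 : (2 : ℝ) * #R * n ≤ 2 / 500 * (n : ℝ) ^ 2 := by
      have : (500 : ℝ) * #R ≤ n := by exact_mod_cast hRc
      nlinarith
    fin_cases i
    · have := h3 1 (by decide)
      have := h3 2 (by decide)
      simp only [Fin.zero_eta, Fin.isValue] at *
      linarith
    · have := h3 0 (by decide)
      have := h3 2 (by decide)
      simp only [Fin.mk_one, Fin.isValue] at *
      linarith
    · have := h3 0 (by decide)
      have := h3 1 (by decide)
      simp only [Fin.reduceFinMk, Fin.isValue] at *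
      linarith
  have hYR : (100000 : ℝ) * #Y ≤ n := by exact_mod_cast hYc
  have hlarge : ∀ i, 0.1 * (n : ℝ) ≤ #(P i) →
      0.1088 * (n : ℝ) ^ 2 ≤ #(P (i + 1)) * #(P (i + 2)) := by
    intro i hi
    obtain ⟨u, hu, huY⟩ := exists_mem_notMem_of_card_lt_card (s := Y) (t := P i) (by
      have : (#Y : ℝ) < #(P i) := by linarith
      exact_mod_cast this)
    refine (hcross i u hu huY).trans ?_
    exact_mod_cast card_cross_le (E := E) (P := P) (i := i) (v := u)
  have hle : ∀ i, (#(P i) : ℝ) ≤ n := fun i => by exact_mod_cast card_le_univ _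
  have hfac : ∀ i j, 0.1088 * (n : ℝ) ^ 2 ≤ #(P i) * #(P j) →
      0.1 * (n : ℝ) ≤ #(P i) ∧ 0.1 * (n : ℝ) ≤ #(P j) := by
    intro i j h
    have hi := hle i
    have hj := hle j
    have hi0 : (0 : ℝ) ≤ #(P i) := by positivity
    have hj0 : (0 : ℝ) ≤ #(P j) := by positivity
    constructor
    · by_contra! hc
      nlinarith
    · by_contra! hc
      nlinarith
  obtain ⟨i, hi⟩ : ∃ i, 0.1 * (n : ℝ) ≤ #(P i) := by
    by_contra! hc
    rw [Fin.sum_univ_three] at hPs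
    linarith [hc 0, hc 1, hc 2]
  have hall : ∀ j, 0.1 * (n : ℝ) ≤ #(P j) := by
    have h1 := hfac _ _ (hlarge i hi)
    intro j
    have : j = i ∨ j = i + 1 ∨ j = i + 2 := by
      clear h1 hi; revert i j; decide
    rcases this with rfl | rfl | rfl
    exacts [hi, h1.1, h1.2]
  exact ⟨P, R, Y, hR, hRc, hYc, mul_card_le_of_cross hP (fun i => hlarge i (hall i)), hcross⟩

/-- An `F_5`-free triple system of large minimum degree is tripartite. -/
theorem F5Free.exists_coloring (hE : IsTripleSystem E) (hF : F5Free E) {X : Finset V}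
    (hX : ∀ x ∈ X, ∀ y z, ¬ E x y z) (hXc : 1000000 * #X ≤ Fintype.card V)
    (hdeg : ∀ v ∉ X, (2 / 9 - 1 / 10000) * (Fintype.card V : ℝ) ^ 2 ≤ #(link E v))
    (hn : 10000000000 ≤ Fintype.card V) :
    ∃ c : V → Fin 3, ∀ x y z, E x y z → c x ≠ c y := by
  classical
  obtain ⟨P, R, Y, hR, hRc, hYc, hPc, hcross⟩ := hF.exists_typical hE hX hXc hdeg hn
  set n := Fintype.card V with hndef
  have hnR : (10000000000 : ℝ) ≤ n := by exact_mod_cast hn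
  have hn2 : (10000000000 : ℝ) * n ≤ (n : ℝ) ^ 2 := by nlinarith
  have hYR : (100000 : ℝ) * #Y ≤ n := by exact_mod_cast hYc
  have hRR : (500 : ℝ) * #R ≤ n := by exact_mod_cast hRc
  have hYn : (#Y : ℝ) * n ≤ 1 / 100000 * (n : ℝ) ^ 2 := by nlinarith
  have hRn : (#R : ℝ) * n ≤ 1 / 500 * (n : ℝ) ^ 2 := by nlinarith
  have hmeet : ∀ (i : Fin 3) (u v w : V), 0.118 * (n : ℝ) ^ 2 ≤ #(cross E P i u) + #(cross E P i v) →
      ∃ p : V × V, E u p.1 p.2 ∧ E v p.1 p.2 ∧ w ≠ p.1 ∧ w ≠ p.2 := by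
    intro i u v w h
    obtain ⟨p, hpu, hpv, hpw⟩ := exists_mem_inter_of_card (T := touching {w})
      (cross_subset (E := E) (P := P) (i := i) (v := u)) (cross_subset (v := v)) (by
        have h1 := mul_card_le_of_card_le hPc (i + 1) (i + 2)
        have h2 : (#(touching ({w} : Finset V)) : ℝ) ≤ 2 * n := by
          have := card_touching_le ({w} : Finset V)
          rw [card_singleton] at this
          exact_mod_cast this
        rw [← Nat.cast_lt (α := ℝ)]
        push_cast [card_product]
        linarith)
    refine ⟨p, (mem_cross.mp hpu).2, (mem_cross.mp hpv).2, ?_⟩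
    simp only [mem_touching, mem_singleton, not_or] at hpw
    exact ⟨fun h => hpw.1 h.symm, fun h => hpw.2 h.symm⟩
  have hmain : ∀ v ∉ X, ∃ i, 0.1 * (n : ℝ) ^ 2 ≤ #(cross E P i v) := by
    intro v hv
    have hlink : (#(link E v) : ℝ) ≤ 2 * (#(cross E P 0 v) + #(cross E P 1 v) +
      #(cross E P 2 v)) + #(innerPairs E P v) + 2 * #R * n := by
        exact_mod_cast hE.card_link_le hR v
    have hd := hdeg v hv
    have hinner : (#(innerPairs E P v) : ℝ) ≤ 2 * #Y * n := by
      have : #(innerPairs E P v) ≤ #(touching Y) := by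
        refine card_le_card fun p hp => ?_
        rw [mem_innerPairs] at hp
        obtain ⟨hvp, i, hp1, hp2⟩ := hp
        rw [mem_touching]
        by_contra! hc
        obtain ⟨q, hq1, hq2, hq3, hq4⟩ := hmeet i p.1 p.2 v (by
          linarith [hcross i _ hp1 hc.1, hcross i _ hp2 hc.2])
        exact hF (hE.rot hq1) (hE.rot hq2) (hE.rot hvp) hq3 hq4
      exact_mod_cast this.trans (card_touching_le Y)
    have hother : ∀ i, 0.02 * (n : ℝ) ^ 2 ≤ #(cross E P i v) → ∀ j, i ≠ j →
        (#(cross E P j v) : ℝ) ≤ 2 * n + #Y * n := by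
      intro i hi j hij
      have := hE.card_cross_le_of_light (P := P) (Y := Y) hij (v := v) (by
        intro u hu huY
        by_contra! hc
        obtain ⟨q, hq1, hq2, -⟩ := hmeet i v u v (by linarith [hcross i _ hu huY])
        exact hF.not_common hc (hE.rot hq1) (hE.rot hq2))
      exact_mod_cast this
    by_contra! hc
    have hc0 := hc 0
    have hc1 := hc 1
    have hc2 := hc 2
    by_cases h0 : 0.02 * (n : ℝ) ^ 2 ≤ #(cross E P 0 v)
    · have := hother 0 h0 1 (by decide)
      have := hother 0 h0 2 (by decide)
      linarith
    by_cases h1 : 0.02 * (n : ℝ) ^ 2 ≤ #(cross E P 1 v)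
    · have := hother 1 h1 0 (by decide)
      have := hother 1 h1 2 (by decide)
      linarith
    by_cases h2 : 0.02 * (n : ℝ) ^ 2 ≤ #(cross E P 2 v)
    · have := hother 2 h2 0 (by decide)
      have := hother 2 h2 1 (by decide)
      linarith
    linarith
  choose! c hc using hmain
  refine ⟨c, fun x y z hxyz hcxy => ?_⟩
  have hx : x ∉ X := fun h => hX x h _ _ hxyz
  have hy : y ∉ X := fun h => hX y h _ _ (hE.swap hxyz)
  have h1 := hc x hx
  have h2 := hc y hy
  rw [← hcxy] at h2
  obtain ⟨q, hq1, hq2, hq3, hq4⟩ := hmeet (c x) x y z (by linarith)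
  exact hF (hE.rot hq1) (hE.rot hq2) hxyz hq3 hq4

end Stability

section Apices

variable {V : Type*} {E : V → V → V → Prop} {t : ℕ}

/-- The vertex `v` is the vertex `f_5` of some copy of `F_5`. -/
def IsApex (E : V → V → V → Prop) (v : V) : Prop :=
  ∃ u w x y, E u w x ∧ E u w y ∧ E x y v ∧ v ≠ u ∧ v ≠ w

/-- The triple system contains no copy of `F_sim(t)`. -/
def SimFree (E : V → V → V → Prop) (t : ℕ) : Prop :=
  ∀ ⦃u w x y v p q⦄, E u w x → E u w y → E x y v → v ≠ u → v ≠ w → E v p q →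
    (p ≠ u ∧ p ≠ w ∧ p ≠ x ∧ p ≠ y) → (q ≠ u ∧ q ≠ w ∧ q ≠ x ∧ q ≠ y) →
    ∀ S : Finset V, (∀ z ∈ S, E p q z ∧ z ≠ u ∧ z ≠ w ∧ z ≠ x ∧ z ≠ y ∧ z ≠ v) → #S < t

variable [Fintype V]

lemma SimFree.exists_light (hS : SimFree E t) {v : V} (hv : IsApex E v) :
    ∃ W : Finset V, #W ≤ 4 ∧
      ∀ p ∈ link E v, p ∉ touching W → #(nbr E p.1 p.2) < t + 5 := by
  classical
  obtain ⟨u, w, x, y, h1, h2, h3, h4, h5⟩ := hv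
  refine ⟨{u, w, x, y}, card_le_four, fun p hp hpW => ?_⟩
  simp only [mem_touching, mem_insert, mem_singleton, not_or] at hpW
  have h6 := hS h1 h2 h3 h4 h5 (mem_link.mp hp) hpW.1 hpW.2
    (nbr E p.1 p.2 \ {u, w, x, y, v}) (by
      intro z hz
      simpa only [mem_sdiff, mem_nbr, mem_insert, mem_singleton, not_or] using hz)
  have h7 := le_card_sdiff {u, w, x, y, v} (nbr E p.1 p.2)
  have h8 : #({u, w, x, y, v} : Finset V) ≤ 5 := card_le_five
  omega

open scoped Classical in
/-- Vertices that are the vertex `f_5` of some copy of `F_5`. -/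
noncomputable def apices (E : V → V → V → Prop) : Finset V := {v | IsApex E v}

@[simp] lemma mem_apices {v : V} : v ∈ apices E ↔ IsApex E v := by simp [apices]

open scoped Classical in
lemma IsTripleSystem.sum_light_le (hE : IsTripleSystem E) (k : ℕ) (X : Finset V) :
    ∑ v ∈ X, #{p ∈ link E v | #(nbr E p.1 p.2) < k} ≤ k * Fintype.card V ^ 2 := by
  calc ∑ v ∈ X, #{p ∈ link E v | #(nbr E p.1 p.2) < k}
      ≤ ∑ v, #{p ∈ link E v | #(nbr E p.1 p.2) < k} :=
        sum_le_sum_of_subset (subset_univ X)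
    _ = ∑ v, ∑ p : V × V, if E v p.1 p.2 ∧ #(nbr E p.1 p.2) < k then 1 else 0 := by
        refine sum_congr rfl fun v _ => ?_
        rw [link, filter_filter, card_filter]
    _ = ∑ p : V × V, ∑ v, if E v p.1 p.2 ∧ #(nbr E p.1 p.2) < k then 1 else 0 := sum_comm
    _ ≤ ∑ p : V × V, k := by
        refine sum_le_sum fun p _ => ?_
        rw [← card_filter]
        by_cases hk : #(nbr E p.1 p.2) < k
        · refine le_trans (card_le_card fun v hv => ?_) hk.le
          rw [mem_nbr]
          exact hE.rot (mem_filter.mp hv).2.1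
        · simp [hk]
    _ = k * Fintype.card V ^ 2 := by
        simp [sq, mul_comm]

lemma SimFree.card_apices_le (hE : IsTripleSystem E) (hS : SimFree E t)
    (hdeg : ∀ v, 0.2 * (Fintype.card V : ℝ) ^ 2 ≤ #(link E v)) (hn : 1000 ≤ Fintype.card V) :
    #(apices E) ≤ 10 * (t + 5) := by
  classical
  set n := Fintype.card V with hndef
  have hnR : (1000 : ℝ) ≤ n := by exact_mod_cast hn
  have h1 : ∀ v ∈ apices E, 0.1 * (n : ℝ) ^ 2 ≤
      #{p ∈ link E v | #(nbr E p.1 p.2) < t + 5} := by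
    intro v hv
    obtain ⟨W, hW, hl⟩ := hS.exists_light (mem_apices.mp hv)
    have h2 : link E v ⊆ {p ∈ link E v | #(nbr E p.1 p.2) < t + 5} ∪ touching W := by
      intro p hp
      by_cases hpW : p ∈ touching W
      · exact mem_union_right _ hpW
      · exact mem_union_left _ (mem_filter.mpr ⟨hp, hl p hp hpW⟩)
    have h3 := (card_le_card h2).trans (card_union_le _ _)
    have h4 := card_touching_le W
    have h5 : (#(link E v) : ℝ) ≤ #{p ∈ link E v | #(nbr E p.1 p.2) < t + 5} + 2 * #W * n := by
      exact_mod_cast h3.trans (by gcongr)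
    have h6 : (#W : ℝ) ≤ 4 := by exact_mod_cast hW
    nlinarith [hdeg v]
  have h2 := hE.sum_light_le (t + 5) (apices E)
  have h3 : (#(apices E) : ℝ) * (0.1 * (n : ℝ) ^ 2) ≤ (t + 5) * (n : ℝ) ^ 2 := by
    calc (#(apices E) : ℝ) * (0.1 * (n : ℝ) ^ 2)
        ≤ ∑ v ∈ apices E, (#{p ∈ link E v | #(nbr E p.1 p.2) < t + 5} : ℝ) := by
          rw [← nsmul_eq_mul]
          exact card_nsmul_le_sum _ _ _ h1
      _ ≤ _ := by exact_mod_cast h2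
  have h4 : (0 : ℝ) < (n : ℝ) ^ 2 := by positivity
  have h5 : (#(apices E) : ℝ) ≤ 10 * (t + 5) := by
    by_contra! hc
    nlinarith
  exact_mod_cast h5

open scoped Classical in
/-- The vertices of colour `i` outside `X`. -/
noncomputable def part (X : Finset V) (c : V → Fin 3) (i : Fin 3) : Finset V :=
  {v | v ∉ X ∧ c v = i}

@[simp] lemma mem_part {X : Finset V} {c : V → Fin 3} {i : Fin 3} {v : V} :
    v ∈ part X c i ↔ v ∉ X ∧ c v = i := by simp [part]

lemma disjoint_part {X : Finset V} {c : V → Fin 3} (i j : Fin 3) (h : i ≠ j) :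
    Disjoint (part X c i) (part X c j) := by
  classical
  rw [Finset.disjoint_left]
  intro v hi hj
  rw [mem_part] at hi hj
  exact h (hi.2.symm.trans hj.2)

lemma card_part (X : Finset V) (c : V → Fin 3) :
    #(part X c 0) + #(part X c 1) + #(part X c 2) + #X = Fintype.card V := by
  classical
  have h := card_not_mem_le (disjoint_part (X := X) (c := c))
  have : (univ.biUnion (part X c))ᶜ = X := by
    ext v; simp
  rw [this] at h
  omega

/-- The apices can be removed to leave a tripartite triple system. -/
lemma SimFree.exists_coloring (hE : IsTripleSystem E) (hS : SimFree E t)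
    (hdeg : ∀ v, (2 / 9 - 1 / 20000) * (Fintype.card V : ℝ) ^ 2 ≤ #(link E v))
    (hn : 10 ^ 10 * (t + 5) ≤ Fintype.card V) :
    ∃ c : V → Fin 3,
      (∀ x y z, x ∉ apices E → y ∉ apices E → z ∉ apices E → E x y z → c x ≠ c y) ∧
      ∀ v ∉ apices E, (1 / 9 - 1 / 20000) * (Fintype.card V : ℝ) ^ 2 ≤
        #(cross E (part (apices E) c) (c v) v) := by
  classical
  set n := Fintype.card V with hndef
  set X := apices E with hX
  have hXc : #X ≤ 10 * (t + 5) := by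
    refine hS.card_apices_le hE (fun v => le_trans ?_ (hdeg v)) (by omega)
    gcongr
    norm_num
  let E' : V → V → V → Prop := fun x y z => E x y z ∧ x ∉ X ∧ y ∉ X ∧ z ∉ X
  have hE' : IsTripleSystem E' :=
    ⟨fun h => ⟨hE.rot h.1, h.2.2.1, h.2.2.2, h.2.1⟩, fun h => ⟨hE.swap h.1, h.2.2.1, h.2.1, h.2.2.2⟩,
      fun h => hE.ne h.1⟩
  have hF' : F5Free E' := by
    intro u w x y z h1 h2 h3 h4 h5
    exact h3.2.2.2 (mem_apices.mpr ⟨u, w, x, y, h1.1, h2.1, h3.1, h4, h5⟩)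
  have hnR : (10 : ℝ) ^ 10 * (t + 5) ≤ n := by exact_mod_cast hn
  have hXR : (#X : ℝ) ≤ 10 * (t + 5) := by exact_mod_cast hXc
  have hXn : (2 : ℝ) * #X * n ≤ 1 / 20000 * (n : ℝ) ^ 2 := by nlinarith
  have hdeg' : ∀ v ∉ X, (2 / 9 - 1 / 10000) * (n : ℝ) ^ 2 ≤ #(link E' v) := by
    intro v hv
    have h1 : link E v ⊆ link E' v ∪ touching X := by
      intro p hp
      by_cases hpX : p ∈ touching X
      · exact mem_union_right _ hpX
      · simp only [mem_touching, not_or] at hpX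
        exact mem_union_left _ (mem_link.mpr ⟨mem_link.mp hp, hv, hpX⟩)
    have h2 := (card_le_card h1).trans (card_union_le _ _)
    have h3 := card_touching_le X
    have h4 : (#(link E v) : ℝ) ≤ #(link E' v) + 2 * #X * n := by
      exact_mod_cast h2.trans (by gcongr)
    linarith [hdeg v]
  obtain ⟨c, hc⟩ := hF'.exists_coloring hE' (X := X) (fun x hx y z h => h.2.1 hx)
    (by omega) hdeg' (by omega)
  refine ⟨c, fun x y z hx hy hz h => hc x y z ⟨h, hx, hy, hz⟩, fun v hv => ?_⟩
  have h1 : link E' v ⊆ cross E (part X c) (c v) v ∪ (cross E (part X c) (c v) v).image Prod.swap := by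
    rintro ⟨x, y⟩ hp
    have h : E' v x y := mem_link.mp hp
    have h1 := hc _ _ _ h
    have h2 := hc _ _ _ (hE'.rot h)
    have h3 := hc _ _ _ (hE'.swap' h)
    have h4 : (c x = c v + 1 ∧ c y = c v + 2) ∨ (c y = c v + 1 ∧ c x = c v + 2) := by
      revert h1 h2 h3
      generalize c x = i
      generalize c y = j
      generalize c v = k
      revert i j k
      decide
    rcases h4 with h4 | h4
    · exact mem_union_left _ (mem_cross.mpr ⟨by simp [h.2.2.1, h.2.2.2, h4], h.1⟩)
    · refine mem_union_right _ (mem_image.mpr ⟨(y, x), mem_cross.mpr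
        ⟨by simp [h.2.2.1, h.2.2.2, h4], hE.swap' h.1⟩, rfl⟩)
  have h2 := (card_le_card h1).trans ((card_union_le _ _).trans
    (add_le_add_right card_image_le _))
  have h3 : (#(link E' v) : ℝ) ≤ #(cross E (part X c) (c v) v) + #(cross E (part X c) (c v) v) := by
    exact_mod_cast h2
  linarith [hdeg' v hv]

end Apices

section Split

variable {V : Type*} {E : V → V → V → Prop} {t : ℕ}

open scoped Classical in
/-- The ordered edges with one vertex in each part, starting in part `i`. -/
noncomputable def transversals (E : V → V → V → Prop) (P : Fin 3 → Finset V) (i : Fin 3) :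
    Finset (V × V × V) :=
  {q ∈ P i ×ˢ P (i + 1) ×ˢ P (i + 2) | E q.1 q.2.1 q.2.2}

lemma mem_transversals {P : Fin 3 → Finset V} {i : Fin 3} {q : V × V × V} :
    q ∈ transversals E P i ↔
      (q.1 ∈ P i ∧ q.2.1 ∈ P (i + 1) ∧ q.2.2 ∈ P (i + 2)) ∧ E q.1 q.2.1 q.2.2 := by
  simp [transversals]

lemma card_transversals (P : Fin 3 → Finset V) (i : Fin 3) :
    #(transversals E P i) = ∑ v ∈ P i, #(cross E P i v) := by
  classical
  simp only [transversals, cross, card_filter, sum_product]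

lemma IsTripleSystem.card_transversals_le (hE : IsTripleSystem E) (P : Fin 3 → Finset V)
    (i j : Fin 3) : #(transversals E P i) ≤ #(transversals E P j) := by
  have e₁ : ∀ i : Fin 3, i + 1 + 1 = i + 2 := by decide
  have e₂ : ∀ i : Fin 3, i + 1 + 2 = i := by decide
  have h : ∀ i, #(transversals E P i) ≤ #(transversals E P (i + 1)) := by
    intro i
    refine card_le_card_of_injOn (fun q => (q.2.1, q.2.2, q.1)) ?_ ?_
    · intro q hq
      obtain ⟨⟨h1, h2, h3⟩, h4⟩ := mem_transversals.mp (mem_coe.mp hq)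
      refine mem_coe.mpr (mem_transversals.mpr ?_)
      rw [e₁, e₂]
      exact ⟨⟨h2, h3, h1⟩, hE.rot h4⟩
    · rintro ⟨a, b, c⟩ - ⟨a', b', c'⟩ - h
      simp only [Prod.mk.injEq] at h ⊢
      exact ⟨h.2.2, h.1, h.2.1⟩
  have h2 : j = i ∨ j = i + 1 ∨ j = i + 1 + 1 := by revert i j; decide
  rcases h2 with rfl | rfl | rfl
  exacts [le_rfl, h _, (h _).trans (h _)]

variable [Fintype V]

lemma IsTripleSystem.card_transversals_add_le (hE : IsTripleSystem E) (P : Fin 3 → Finset V)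
    (i : Fin 3) {k : ℕ} {C : Finset (V × V)} (hC : C ⊆ P (i + 1) ×ˢ P (i + 2))
    (hk : ∀ p ∈ C, #(nbr E p.1 p.2) ≤ k) :
    #(transversals E P i) + #C * #(P i) ≤ #(P i) * (#(P (i + 1)) * #(P (i + 2))) + #C * k := by
  classical
  have h1 : #(transversals E P i) =
      ∑ p ∈ P (i + 1) ×ˢ P (i + 2), #{v ∈ P i | E v p.1 p.2} := by
    rw [card_transversals]
    simp only [cross, card_filter]
    exact sum_comm
  have h2 : ∑ p ∈ P (i + 1) ×ˢ P (i + 2) \ C, #{v ∈ P i | E v p.1 p.2} ≤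
      #(P (i + 1) ×ˢ P (i + 2) \ C) * #(P i) :=
    sum_le_card_nsmul _ _ _ (fun p _ => card_filter_le _ _)
  have h3 : ∑ p ∈ C, #{v ∈ P i | E v p.1 p.2} ≤ #C * k := by
    refine sum_le_card_nsmul _ _ _ fun p hp => le_trans (card_le_card fun v hv => ?_) (hk p hp)
    exact mem_nbr.mpr (hE.rot (mem_filter.mp hv).2)
  have h4 := card_sdiff_add_card_eq_card hC
  rw [card_product] at h4
  rw [h1, ← sum_sdiff hC, ← h4]
  nlinarith

/-- A triple system that is tripartite outside the set of apices, with large degrees. -/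
structure IsSplit (E : V → V → V → Prop) (t : ℕ) (c : V → Fin 3) : Prop where
  isTripleSystem : IsTripleSystem E
  simFree : SimFree E t
  color : ∀ {x y z}, x ∉ apices E → y ∉ apices E → z ∉ apices E → E x y z → c x ≠ c y
  le_cross : ∀ {v}, v ∉ apices E →
    0.111 * (Fintype.card V : ℝ) ^ 2 ≤ #(cross E (part (apices E) c) (c v) v)
  le_link : ∀ v, 0.222 * (Fintype.card V : ℝ) ^ 2 ≤ #(link E v)
  card_apices : #(apices E) ≤ 10 * (t + 5)
  large : 10 ^ 10 * (t + 5) ^ 2 ≤ Fintype.card V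

namespace IsSplit

variable {c : V → Fin 3}

lemma large_real (h : IsSplit E t c) : (10 : ℝ) ^ 10 * (t + 5) ^ 2 ≤ Fintype.card V := by
  exact_mod_cast h.large

lemma large_real' (h : IsSplit E t c) : (10 : ℝ) ^ 10 * (t + 5) ≤ Fintype.card V := by
  have := h.large_real
  have : (0 : ℝ) ≤ t := by positivity
  nlinarith

lemma card_apices_real (h : IsSplit E t c) : (#(apices E) : ℝ) ≤ 10 * (t + 5) := by
  exact_mod_cast h.card_apices

lemma card_part_le (h : IsSplit E t c) :
    ∀ i, (#(part (apices E) c i) : ℝ) ≤ 0.3408 * Fintype.card V := by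
  classical
  set n := Fintype.card V with hndef
  have hn := h.large_real'
  have ht0 : (0 : ℝ) ≤ t := by positivity
  have hn0 : (0 : ℝ) < n := by nlinarith
  have key : ∀ v ∉ apices E, 0.111 * (n : ℝ) ^ 2 ≤
      #(part (apices E) c (c v + 1)) * #(part (apices E) c (c v + 2)) := by
    intro v hv
    refine (h.le_cross hv).trans ?_
    exact_mod_cast card_cross_le (E := E) (P := part (apices E) c) (i := c v) (v := v)
  have hne : ∀ i, (part (apices E) c i).Nonempty := by
    have : ∃ v, v ∉ apices E := by
      by_contra! hc
      have h1 : #(apices E) = n := by rw [eq_univ_iff_forall.mpr hc]; exact card_univ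
      have h2 := h.card_apices_real
      rw [h1] at h2
      linarith
    obtain ⟨v, hv⟩ := this
    have h1 := key v hv
    have h2 : part (apices E) c (c v + 1) ≠ ∅ := by
      intro h0
      rw [h0] at h1
      simp only [card_empty, Nat.cast_zero, zero_mul] at h1
      nlinarith
    have h3 : part (apices E) c (c v + 2) ≠ ∅ := by
      intro h0
      rw [h0] at h1
      simp only [card_empty, Nat.cast_zero, mul_zero] at h1
      nlinarith
    intro i
    have : i = c v ∨ i = c v + 1 ∨ i = c v + 2 := by
      generalize c v = j
      revert i j; decide
    rcases this with rfl | rfl | rfl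
    · exact ⟨v, mem_part.mpr ⟨hv, rfl⟩⟩
    · exact nonempty_iff_ne_empty.mpr h2
    · exact nonempty_iff_ne_empty.mpr h3
  refine mul_card_le_of_cross disjoint_part fun i => ?_
  obtain ⟨v, hv⟩ := hne i
  rw [mem_part] at hv
  have := key v hv.1
  rw [hv.2] at this
  refine le_trans ?_ this
  gcongr
  norm_num

lemma le_card_part (h : IsSplit E t c) (i : Fin 3) :
    0.318 * (Fintype.card V : ℝ) ≤ #(part (apices E) c i) := by
  have h1 := h.card_part_le
  have h2 : (#(part (apices E) c 0) : ℝ) + #(part (apices E) c 1) + #(part (apices E) c 2) +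
      #(apices E) = Fintype.card V := by exact_mod_cast card_part (apices E) c
  have h3 := h.card_apices_real
  have h4 := h.large_real'
  have ha := h1 0
  have hb := h1 1
  have hc := h1 2
  fin_cases i
  all_goals simp only [Fin.zero_eta, Fin.mk_one, Fin.reduceFinMk, Fin.isValue]; linarith

lemma card_cross_le_of_apex (h : IsSplit E t c) {x : V} (hx : x ∈ apices E) (i : Fin 3) :
    (#(cross E (part (apices E) c) i x) : ℝ) ≤ 0.008 * (Fintype.card V : ℝ) ^ 2 := by
  classical
  set n := Fintype.card V with hndef
  set P := part (apices E) c with hP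
  have hn := h.large_real'
  have ht0 : (0 : ℝ) ≤ t := by positivity
  obtain ⟨W, hW, hl⟩ := h.simFree.exists_light (mem_apices.mp hx)
  set C := cross E P i x \ touching W with hC
  have h1 : #(cross E P i x) ≤ #C + #(touching W) := by
    rw [← tsub_le_iff_right]; exact le_card_sdiff _ _
  have h2 := card_touching_le W
  have h3 := h.isTripleSystem.card_transversals_add_le P i (k := t + 5) (C := C)
    (sdiff_subset.trans cross_subset) (by
      intro p hp
      rw [hC, mem_sdiff] at hp
      exact (hl p (mem_link.mpr (mem_cross.mp hp.1).2) hp.2).le)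
  have h4 : (#(P i) : ℝ) * (0.111 * (n : ℝ) ^ 2) ≤ #(transversals E P i) := by
    rw [card_transversals, ← nsmul_eq_mul]
    push_cast
    refine card_nsmul_le_sum _ _ _ fun v hv => ?_
    rw [hP, mem_part] at hv
    have := h.le_cross hv.1
    rwa [hv.2] at this
  have h5 := mul_card_le_of_card_le h.card_part_le (i + 1) (i + 2)
  have h6 := h.card_part_le i
  have h7 := h.le_card_part i
  rw [← hP] at h5 h6 h7
  have h8 : (#(transversals E P i) : ℝ) + #C * #(P i) ≤
      #(P i) * (#(P (i + 1)) * #(P (i + 2))) + #C * (t + 5) := by exact_mod_cast h3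
  have h9 : (#(P i) : ℝ) * (#(P (i + 1)) * #(P (i + 2))) ≤ #(P i) * (0.117 * (n : ℝ) ^ 2) := by
    gcongr
  have h10 : (#C : ℝ) * (0.3 * n) ≤ #C * (#(P i) - (t + 5)) := by
    gcongr
    linarith
  have h11 : (#(P i) : ℝ) * (0.006 * (n : ℝ) ^ 2) ≤ 0.3408 * n * (0.006 * (n : ℝ) ^ 2) := by
    gcongr
  have hn0 : (0 : ℝ) < n := by linarith
  have h12 : (#C : ℝ) ≤ 0.007 * (n : ℝ) ^ 2 := by
    by_contra! hcon
    have : 0.007 * (n : ℝ) ^ 2 * (0.3 * n) < #C * (0.3 * n) := by gcongr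
    have h13 : (0 : ℝ) < n ^ 3 := by positivity
    nlinarith
  have h13 : (#(cross E P i x) : ℝ) ≤ #C + 2 * #W * n := by
    exact_mod_cast h1.trans (by gcongr)
  have h14 : (#W : ℝ) ≤ 4 := by exact_mod_cast hW
  nlinarith

lemma le_innerPairs (h : IsSplit E t c) {x : V} (hx : x ∈ apices E) :
    0.17 * (Fintype.card V : ℝ) ^ 2 ≤ #(innerPairs E (part (apices E) c) x) := by
  have h1 := h.isTripleSystem.card_link_le (P := part (apices E) c) (R := apices E)
    (fun v hv => ⟨c v, mem_part.mpr ⟨hv, rfl⟩⟩) x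
  have h2 : (#(link E x) : ℝ) ≤ 2 * (#(cross E (part (apices E) c) 0 x) +
      #(cross E (part (apices E) c) 1 x) + #(cross E (part (apices E) c) 2 x)) +
      #(innerPairs E (part (apices E) c) x) + 2 * #(apices E) * Fintype.card V := by
    exact_mod_cast h1
  have h3 := h.le_link x
  have h4 := h.card_apices_real
  have h5 := h.large_real'
  have := h.card_cross_le_of_apex hx 0
  have := h.card_cross_le_of_apex hx 1
  have := h.card_cross_le_of_apex hx 2
  nlinarith

/-- Apices are apices robustly. -/
lemma exists_avoiding (h : IsSplit E t c) {x : V} (hx : x ∈ apices E) (W : Finset V)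
    (hW : #W ≤ t + 4) :
    ∃ u w p q, E u w p ∧ E u w q ∧ E p q x ∧ x ≠ u ∧ x ≠ w ∧
      u ∉ W ∧ w ∉ W ∧ p ∉ W ∧ q ∉ W := by
  classical
  set n := Fintype.card V with hndef
  set P := part (apices E) c with hP
  have hn := h.large_real'
  have ht0 : (0 : ℝ) ≤ t := by positivity
  have h1 := h.le_innerPairs hx
  have htouch : (#(touching (insert x W)) : ℝ) ≤ 0.0001 * (n : ℝ) ^ 2 := by
    have h2 : (#(touching (insert x W)) : ℝ) ≤ 2 * #(insert x W) * n := by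
      exact_mod_cast card_touching_le (insert x W)
    have h3 : #(insert x W) ≤ t + 5 := (card_insert_le _ _).trans (by omega)
    have h4 : (#(insert x W) : ℝ) ≤ t + 5 := by exact_mod_cast h3
    nlinarith
  obtain ⟨⟨p, q⟩, hpq, hpqW⟩ := exists_mem_notMem_of_card_lt_card
    (s := touching (insert x W)) (t := innerPairs E P x) (by
      have : (#(touching (insert x W)) : ℝ) < #(innerPairs E P x) := by nlinarith
      exact_mod_cast this)
  rw [mem_innerPairs] at hpq
  obtain ⟨hxpq, i, hpi, hqi⟩ := hpq
  simp only at hxpq hpi hqi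
  have hp := mem_part.mp hpi
  have hq := mem_part.mp hqi
  have h2 := h.le_cross hp.1
  have h3 := h.le_cross hq.1
  rw [hp.2] at h2
  rw [hq.2] at h3
  obtain ⟨⟨u, w⟩, hu, hu', huW⟩ := exists_mem_inter_of_card (T := touching (insert x W))
    (cross_subset (E := E) (P := P) (i := i) (v := p)) (cross_subset (v := q)) (by
      have h4 := mul_card_le_of_card_le h.card_part_le (i + 1) (i + 2)
      rw [← Nat.cast_lt (α := ℝ)]
      push_cast [card_product]
      nlinarith)
  simp only [mem_touching, mem_insert, not_or] at hpqW huW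
  have hE := h.isTripleSystem
  exact ⟨u, w, p, q, hE.rot (mem_cross.mp hu).2, hE.rot (mem_cross.mp hu').2, hE.rot hxpq,
    fun h => huW.1.1 h.symm, fun h => huW.2.1 h.symm, huW.1.2, huW.2.2, hpqW.1.2, hpqW.2.2⟩

lemma card_nbr_le (h : IsSplit E t c) {x u w : V} (hx : x ∈ apices E) (hxuw : E x u w) :
    #(nbr E u w) ≤ t := by
  classical
  by_contra! hc
  have hE := h.isTripleSystem
  have hxn : x ∈ nbr E u w := mem_nbr.mpr (hE.rot hxuw)
  obtain ⟨S, hS, hSc⟩ := exists_subset_card_eq (s := (nbr E u w).erase x) (n := t)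
    (by rw [card_erase_of_mem hxn]; omega)
  obtain ⟨a, b, p, q, h1, h2, h3, h4, h5, ha, hb, hp, hq⟩ :=
    h.exists_avoiding hx (insert u (insert w S)) (by
      have := card_insert_le u (insert w S)
      have := card_insert_le w S
      omega)
  simp only [mem_insert, not_or] at ha hb hp hq
  have := h.simFree h1 h2 h3 h4 h5 hxuw ⟨Ne.symm ha.1, Ne.symm hb.1, Ne.symm hp.1, Ne.symm hq.1⟩
    ⟨Ne.symm ha.2.1, Ne.symm hb.2.1, Ne.symm hp.2.1, Ne.symm hq.2.1⟩ S (by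
      intro z hz
      have hz' := mem_erase.mp (hS hz)
      refine ⟨mem_nbr.mp hz'.2, ?_, ?_, ?_, ?_, hz'.1⟩ <;> rintro rfl
      exacts [ha.2.2 hz, hb.2.2 hz, hp.2.2 hz, hq.2.2 hz])
  omega

end IsSplit

end Split

section Counting

variable {V : Type*} [Fintype V] {E : V → V → V → Prop} {t : ℕ}

open scoped Classical in
/-- The ordered edges of a triple system. -/
noncomputable def triples (E : V → V → V → Prop) : Finset (V × V × V) := {q | E q.1 q.2.1 q.2.2}

@[simp] lemma mem_triples {q : V × V × V} : q ∈ triples E ↔ E q.1 q.2.1 q.2.2 := by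
  simp [triples]

open scoped Classical in
/-- The ordered edges with at least two vertices in `X`. -/
noncomputable def doubleTriples (E : V → V → V → Prop) (X : Finset V) : Finset (V × V × V) :=
  {q ∈ triples E | (q.1 ∈ X ∧ q.2.1 ∈ X) ∨ (q.2.1 ∈ X ∧ q.2.2 ∈ X) ∨ (q.2.2 ∈ X ∧ q.1 ∈ X)}

lemma card_union_rotations_le {α : Type*} [DecidableEq α] (S : Finset (α × α × α)) :
    #(S ∪ S.image (fun q => (q.2.2, q.1, q.2.1)) ∪ S.image (fun q => (q.2.1, q.2.2, q.1))) ≤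
      3 * #S := by
  have h1 := card_union_le (S ∪ S.image (fun q => (q.2.2, q.1, q.2.1)))
    (S.image (fun q => (q.2.1, q.2.2, q.1)))
  have h2 := card_union_le S (S.image (fun q => (q.2.2, q.1, q.2.1)))
  have h3 : #(S.image (fun q => (q.2.2, q.1, q.2.1))) ≤ #S := card_image_le
  have h4 : #(S.image (fun q => (q.2.1, q.2.2, q.1))) ≤ #S := card_image_le
  omega

lemma card_doubleTriples_le (X : Finset V) :
    #(doubleTriples E X) ≤ 3 * (#X ^ 2 * Fintype.card V) := by
  classical
  have h : doubleTriples E X ⊆ (X ×ˢ X ×ˢ univ) ∪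
      (X ×ˢ X ×ˢ univ).image (fun q => (q.2.2, q.1, q.2.1)) ∪
      (X ×ˢ X ×ˢ univ).image (fun q => (q.2.1, q.2.2, q.1)) := by
    rintro ⟨x, y, z⟩ hq
    rcases (mem_filter.mp hq).2 with h | h | h
    · exact mem_union_left _ (mem_union_left _ (by simpa using h))
    · exact mem_union_left _ (mem_union_right _ (mem_image.mpr ⟨(y, z, x), by simpa using h, rfl⟩))
    · exact mem_union_right _ (mem_image.mpr ⟨(z, x, y), by simpa using h, rfl⟩)
  refine (card_le_card h).trans ((card_union_rotations_le _).trans (le_of_eq ?_))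
  simp only [card_product, card_univ]
  ring

omit [Fintype V] in
lemma IsTripleSystem.card_le_choose_three (hE : IsTripleSystem E) {X : Finset V}
    {S : Finset (V × V × V)} (hS : ∀ q ∈ S, E q.1 q.2.1 q.2.2 ∧ q.1 ∈ X ∧ q.2.1 ∈ X ∧ q.2.2 ∈ X) :
    #S ≤ 6 * (#X).choose 3 := by
  classical
  have h : S ⊆ X.offDiag.biUnion
      (fun p => ((X.erase p.1).erase p.2).image (fun z => (p.1, p.2, z))) := by
    rintro ⟨x, y, z⟩ hq
    obtain ⟨h1, h2, h3, h4⟩ := hS _ hq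
    rw [mem_biUnion]
    refine ⟨(x, y), mem_offDiag.mpr ⟨h2, h3, hE.ne h1⟩, mem_image.mpr ⟨z, ?_, rfl⟩⟩
    exact mem_erase.mpr ⟨(hE.ne'' h1).symm, mem_erase.mpr ⟨(hE.ne' h1).symm, h4⟩⟩
  have h2 := (card_le_card h).trans (card_biUnion_le_card_mul _ _ (#X - 2) (by
    intro p hp
    obtain ⟨h1, h2, h3⟩ := mem_offDiag.mp hp
    refine card_image_le.trans ?_
    rw [card_erase_of_mem (mem_erase.mpr ⟨h3.symm, h2⟩), card_erase_of_mem h1]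
    omega))
  refine h2.trans (le_of_eq ?_)
  have h3 := Nat.descFactorial_eq_factorial_mul_choose (#X) 3
  rw [show Nat.factorial 3 = 6 from rfl] at h3
  rw [← h3, offDiag_card, ← Nat.mul_sub_one]
  simp [Nat.descFactorial]
  ring

open scoped Classical in
/-- The ordered pairs of distinct vertices of the same part. -/
noncomputable def monoPairs (P : Fin 3 → Finset V) : Finset (V × V) :=
  univ.biUnion fun i => (P i).offDiag

omit [Fintype V] in
lemma card_monoPairs_le (P : Fin 3 → Finset V) :
    #(monoPairs P) ≤ 2 * ((#(P 0)).choose 2 + (#(P 1)).choose 2 + (#(P 2)).choose 2) := by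
  classical
  have h : ∀ k : ℕ, k * k - k = 2 * k.choose 2 := by
    intro k
    have := Nat.descFactorial_eq_factorial_mul_choose k 2
    rw [show Nat.factorial 2 = 2 from rfl] at this
    rw [← this, ← Nat.mul_sub_one]
    simp [Nat.descFactorial]
    ring
  refine card_biUnion_le.trans (le_of_eq ?_)
  simp only [offDiag_card, h, Fin.sum_univ_three]
  ring

lemma IsTripleSystem.innerPairs_subset (hE : IsTripleSystem E) (P : Fin 3 → Finset V) (x : V) :
    innerPairs E P x ⊆ monoPairs P := by
  intro p hp
  obtain ⟨h, i, h1, h2⟩ := mem_innerPairs.mp hp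
  simp only [monoPairs, mem_biUnion, mem_univ, true_and]
  exact ⟨i, mem_offDiag.mpr ⟨h1, h2, hE.ne'' h⟩⟩

lemma sum_card_le_of_card_nbr_le (hE : IsTripleSystem E) {X : Finset V} {T : Finset (V × V)}
    {F : V → Finset (V × V)} (hF : ∀ x ∈ X, F x ⊆ T) (hFE : ∀ x, ∀ p ∈ F x, E x p.1 p.2)
    (ht : ∀ x ∈ X, ∀ p ∈ F x, #(nbr E p.1 p.2) ≤ t) :
    ∑ x ∈ X, #(F x) ≤ t * #T := by
  classical
  calc ∑ x ∈ X, #(F x) = ∑ x ∈ X, ∑ p ∈ T, if p ∈ F x then 1 else 0 := by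
        refine sum_congr rfl fun x hx => ?_
        rw [← card_filter]
        congr 1
        ext p
        simpa using fun h => hF x hx h
    _ = ∑ p ∈ T, ∑ x ∈ X, if p ∈ F x then 1 else 0 := sum_comm
    _ ≤ ∑ p ∈ T, t := by
        refine sum_le_sum fun p _ => ?_
        rw [← card_filter]
        rcases (X.filter (fun x => p ∈ F x)).eq_empty_or_nonempty with h | ⟨x, hx⟩
        · simp [h]
        · rw [mem_filter] at hx
          refine le_trans (card_le_card fun y hy => ?_) (ht x hx.1 p hx.2)
          exact mem_nbr.mpr (hE.rot (hFE y p (mem_filter.mp hy).2))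
    _ = t * #T := by simp [mul_comm]

namespace IsSplit

variable {c : V → Fin 3}

lemma card_triples_le_add (h : IsSplit E t c) :
    #(triples E) ≤ 6 * #(transversals E (part (apices E) c) 0) +
      3 * ∑ x ∈ apices E, (#(innerPairs E (part (apices E) c) x) +
        2 * ∑ i, #(cross E (part (apices E) c) i x)) + #(doubleTriples E (apices E)) := by
  classical
  set X := apices E with hX
  set P := part X c with hP
  have hE := h.isTripleSystem
  set S : V → Finset (V × V) := fun x => innerPairs E P x ∪
    univ.biUnion (fun i => cross E P i x ∪ (cross E P i x).image Prod.swap) with hS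
  set B : Finset (V × V × V) := X.biUnion fun x => (S x).image (fun p => (x, p)) with hB
  set A : Finset (V × V × V) := univ.biUnion fun i =>
    transversals E P i ∪ (transversals E P i).image (fun q => (q.1, q.2.2, q.2.1)) with hA
  have hmemP : ∀ {v i}, v ∈ P i ↔ v ∉ X ∧ c v = i := mem_part
  have hmemB : ∀ x y z, E x y z → x ∈ X → y ∉ X → z ∉ X → (x, y, z) ∈ B := by
    intro x y z hxyz hx hy hz
    refine mem_biUnion.mpr ⟨x, hx, mem_image.mpr ⟨(y, z), ?_, rfl⟩⟩
    by_cases hc : c y = c z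
    · exact mem_union_left _ (mem_innerPairs.mpr ⟨hxyz, c y, hmemP.mpr ⟨hy, rfl⟩,
        hmemP.mpr ⟨hz, hc.symm⟩⟩)
    · refine mem_union_right _ (mem_biUnion.mpr ?_)
      have : ∃ i, (c y = i + 1 ∧ c z = i + 2) ∨ (c z = i + 1 ∧ c y = i + 2) := by
        revert hc
        generalize c y = j
        generalize c z = k
        revert j k
        decide
      obtain ⟨i, hi | hi⟩ := this
      · exact ⟨i, mem_univ _, mem_union_left _ (mem_cross.mpr
          ⟨⟨hmemP.mpr ⟨hy, hi.1⟩, hmemP.mpr ⟨hz, hi.2⟩⟩, hxyz⟩)⟩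
      · exact ⟨i, mem_univ _, mem_union_right _ (mem_image.mpr ⟨(z, y), mem_cross.mpr
          ⟨⟨hmemP.mpr ⟨hz, hi.1⟩, hmemP.mpr ⟨hy, hi.2⟩⟩, hE.swap' hxyz⟩, rfl⟩)⟩
  have hmemA : ∀ x y z, E x y z → x ∉ X → y ∉ X → z ∉ X → (x, y, z) ∈ A := by
    intro x y z hxyz hx hy hz
    have h1 := h.color hx hy hz hxyz
    have h2 := h.color hy hz hx (hE.rot hxyz)
    have h3 := h.color hx hz hy (hE.swap' hxyz)
    have h4 : (c y = c x + 1 ∧ c z = c x + 2) ∨ (c z = c x + 1 ∧ c y = c x + 2) := by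
      revert h1 h2 h3
      generalize c x = i
      generalize c y = j
      generalize c z = k
      revert i j k
      decide
    refine mem_biUnion.mpr ⟨c x, mem_univ _, ?_⟩
    rcases h4 with h4 | h4
    · exact mem_union_left _ (mem_transversals.mpr ⟨⟨hmemP.mpr ⟨hx, rfl⟩, hmemP.mpr ⟨hy, h4.1⟩,
        hmemP.mpr ⟨hz, h4.2⟩⟩, hxyz⟩)
    · exact mem_union_right _ (mem_image.mpr ⟨(x, z, y), mem_transversals.mpr
        ⟨⟨hmemP.mpr ⟨hx, rfl⟩, hmemP.mpr ⟨hz, h4.1⟩, hmemP.mpr ⟨hy, h4.2⟩⟩, hE.swap' hxyz⟩, rfl⟩)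
  have hsub : triples E ⊆ A ∪ (B ∪ B.image (fun q => (q.2.2, q.1, q.2.1)) ∪
      B.image (fun q => (q.2.1, q.2.2, q.1))) ∪ doubleTriples E X := by
    rintro ⟨x, y, z⟩ hq
    have hxyz : E x y z := mem_triples.mp hq
    by_cases hd : (x, y, z) ∈ doubleTriples E X
    · exact mem_union_right _ hd
    refine mem_union_left _ ?_
    simp only [doubleTriples, mem_filter, hq, true_and, not_or, not_and] at hd
    by_cases hx : x ∈ X
    · exact mem_union_right _ (mem_union_left _ (mem_union_left _
        (hmemB x y z hxyz hx (hd.1 hx) (fun hz => hd.2.2 hz hx))))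
    by_cases hy : y ∈ X
    · exact mem_union_right _ (mem_union_left _ (mem_union_right _ (mem_image.mpr
        ⟨(y, z, x), hmemB y z x (hE.rot hxyz) hy (hd.2.1 hy) hx, rfl⟩)))
    by_cases hz : z ∈ X
    · exact mem_union_right _ (mem_union_right _ (mem_image.mpr
        ⟨(z, x, y), hmemB z x y (hE.rot (hE.rot hxyz)) hz hx hy, rfl⟩))
    exact mem_union_left _ (hmemA x y z hxyz hx hy hz)
  have hAc : #A ≤ 6 * #(transversals E P 0) := by
    have h1 : #A ≤ #(univ : Finset (Fin 3)) * (2 * #(transversals E P 0)) := by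
      refine card_biUnion_le_card_mul _ _ _ fun i _ => ?_
      have h2 := card_union_le (transversals E P i)
        ((transversals E P i).image (fun q => (q.1, q.2.2, q.2.1)))
      have h3 : #((transversals E P i).image (fun q => (q.1, q.2.2, q.2.1))) ≤
        #(transversals E P i) := card_image_le
      have h4 := hE.card_transversals_le P i 0
      omega
    rw [card_univ, Fintype.card_fin] at h1
    omega
  have hBc : #B ≤ ∑ x ∈ X, (#(innerPairs E P x) + 2 * ∑ i, #(cross E P i x)) := by
    refine card_biUnion_le.trans (sum_le_sum fun x _ => card_image_le.trans ?_)
    refine (card_union_le _ _).trans (add_le_add_right (card_biUnion_le.trans ?_) _)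
    rw [mul_sum]
    refine sum_le_sum fun i _ => (card_union_le _ _).trans ?_
    have : #((cross E P i x).image Prod.swap) ≤ #(cross E P i x) := card_image_le
    omega
  refine (card_le_card hsub).trans ((card_union_le _ _).trans (add_le_add_left
    ((card_union_le _ _).trans (add_le_add hAc ?_)) _))
  exact (card_union_rotations_le B).trans (Nat.mul_le_mul_left 3 hBc)

lemma transversals_add_le (h : IsSplit E t c) :
    #(transversals E (part (apices E) c) 0) +
      ∑ x ∈ apices E, ∑ i, #(cross E (part (apices E) c) i x) ≤
    #(part (apices E) c 0) * #(part (apices E) c 1) * #(part (apices E) c 2) := by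
  classical
  set X := apices E with hX
  set P := part X c with hP
  set n := Fintype.card V with hn
  have hE := h.isTripleSystem
  have hn := h.large_real'
  have ht0 : (0 : ℝ) ≤ t := by positivity
  set C : Fin 3 → Finset (V × V) := fun i => X.biUnion (cross E P i) with hC
  have h1 : ∀ i, ∑ x ∈ X, #(cross E P i x) ≤ t * #(C i) := by
    intro i
    refine sum_card_le_of_card_nbr_le hE (fun x hx => subset_biUnion_of_mem _ hx)
      (fun x p hp => (mem_cross.mp hp).2) (fun x hx p hp => h.card_nbr_le hx (mem_cross.mp hp).2)
  have h2 : ∀ i, (#(transversals E P 0) : ℝ) + #(C i) * (0.3 * n) ≤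
      #(P i) * (#(P (i + 1)) * #(P (i + 2))) := by
    intro i
    have h3 := hE.card_transversals_add_le P i (k := t) (C := C i)
      (biUnion_subset.mpr fun x _ => cross_subset) (by
        intro p hp
        obtain ⟨x, hx, hp⟩ := mem_biUnion.mp hp
        exact h.card_nbr_le hx (mem_cross.mp hp).2)
    have h4 := hE.card_transversals_le P 0 i
    have h5 : (#(transversals E P 0) : ℝ) + #(C i) * #(P i) ≤
      #(P i) * (#(P (i + 1)) * #(P (i + 2))) + #(C i) * t := by
        exact_mod_cast (Nat.add_le_add_right h4 _).trans h3
    have h6 : (#(C i) : ℝ) * (0.3 * n) ≤ #(C i) * (#(P i) - t) := by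
      gcongr
      have := h.le_card_part i
      rw [← hP] at this
      linarith
    linarith
  have h3 : ∀ i, (∑ x ∈ X, #(cross E P i x) : ℝ) ≤ 0.1 * n * #(C i) := by
    intro i
    have h4 : (∑ x ∈ X, #(cross E P i x) : ℝ) ≤ t * #(C i) := by exact_mod_cast h1 i
    refine h4.trans ?_
    gcongr
    linarith
  rw [sum_comm, Fin.sum_univ_three, ← Nat.cast_le (α := ℝ)]
  push_cast
  have ha := h2 0
  have hb := h2 1
  have hc := h2 2
  have ha' := h3 0
  have hb' := h3 1
  have hc' := h3 2
  simp only [Fin.isValue, zero_add, Fin.reduceAdd] at ha hb hc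
  linarith

lemma card_triples_le_of_sum_le (h : IsSplit E t c) {I : ℕ}
    (hI : ∑ x ∈ apices E, #(innerPairs E (part (apices E) c) x) ≤ I) :
    #(triples E) ≤ 6 * (#(part (apices E) c 0) * #(part (apices E) c 1) *
      #(part (apices E) c 2)) + 3 * I + #(doubleTriples E (apices E)) := by
  have h1 := h.card_triples_le_add
  have h2 := h.transversals_add_le
  rw [sum_add_distrib, ← mul_sum] at h1
  omega

lemma sum_innerPairs_le (h : IsSplit E t c) :
    ∑ x ∈ apices E, #(innerPairs E (part (apices E) c) x) ≤
      t * #(monoPairs (part (apices E) c)) :=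
  sum_card_le_of_card_nbr_le h.isTripleSystem (fun _ _ => h.isTripleSystem.innerPairs_subset _ _)
    (fun _ _ hp => (mem_innerPairs.mp hp).1)
    (fun _ hx _ hp => h.card_nbr_le hx (mem_innerPairs.mp hp).1)

lemma sum_innerPairs_le' (h : IsSplit E t c) (Y : Finset V) :
    ∑ x ∈ Y, #(innerPairs E (part (apices E) c) x) ≤
      #Y * #(monoPairs (part (apices E) c)) :=
  sum_le_card_nsmul _ _ _ fun _ _ => card_le_card (h.isTripleSystem.innerPairs_subset _ _)

/-- If some edge meets the set of apices in exactly two vertices, then the links of the apices are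
far from complete. -/
lemma sum_innerPairs_le_of_edge (h : IsSplit E t c) {x y z : V} (hx : x ∈ apices E)
    (hy : y ∈ apices E) (hz : z ∉ apices E) (hxyz : E x y z) :
    ∑ v ∈ apices E, #(innerPairs E (part (apices E) c) v) +
      #(monoPairs (part (apices E) c)) ≤
      #(apices E) * #(monoPairs (part (apices E) c)) + 2 * Fintype.card V := by
  classical
  have hE := h.isTripleSystem
  set P := part (apices E) c with hP
  have h1 : #(innerPairs E P x) + #(innerPairs E P y) ≤ #(monoPairs P) + 2 * Fintype.card V := by
    by_contra! hc
    obtain ⟨p, hpx, hpy, hpz⟩ := exists_mem_inter_of_card (T := touching {z})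
      (hE.innerPairs_subset P x) (hE.innerPairs_subset P y) (by
        have := card_touching_le ({z} : Finset V)
        rw [card_singleton] at this
        omega)
    simp only [mem_touching, mem_singleton, not_or] at hpz
    exact hz (mem_apices.mpr ⟨p.1, p.2, x, y, hE.rot (mem_innerPairs.mp hpx).1,
      hE.rot (mem_innerPairs.mp hpy).1, hxyz, Ne.symm hpz.1, Ne.symm hpz.2⟩)
  have hy' : y ∈ (apices E).erase x := mem_erase.mpr ⟨(hE.ne hxyz).symm, hy⟩
  have h2 := add_sum_erase (apices E) (fun v => #(innerPairs E P v)) hx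
  have h3 := add_sum_erase ((apices E).erase x) (fun v => #(innerPairs E P v)) hy'
  have h4 := h.sum_innerPairs_le' (((apices E).erase x).erase y)
  have h5 := card_erase_add_one hx
  have h6 := card_erase_add_one hy'
  rw [← h5, ← h6]
  rw [← h2, ← h3]
  rw [← hP] at h4
  nlinarith

end IsSplit

end Counting

section Numerics

variable {n a b c s d : ℝ}

lemma numeric_few_apices (ha : 0.318 * n ≤ a) (ha' : a ≤ 0.3408 * n)
    (hb : 0.318 * n ≤ b) (hb' : b ≤ 0.3408 * n) (hc : 0.318 * n ≤ c) (hc' : c ≤ 0.3408 * n)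
    (hs : 0 ≤ s) (hd : 1 ≤ d) (hn : 1000 ≤ n) (h1 : (s + d) * n ≤ 0.001 * n ^ 2)
    (h2 : (s + d) ^ 2 * n ≤ 0.001 * n ^ 2) :
    6 * (a * b * c) + 3 * (s * (a * (a - 1) + b * (b - 1) + c * (c - 1))) + 3 * (s ^ 2 * n) ≤
    6 * ((a - d) * b * c +
      (s + d) * ((a - d) * (a - d - 1) / 2 + b * (b - 1) / 2 + c * (c - 1) / 2)) := by
  set q := a * (a - 1) + b * (b - 1) + c * (c - 1) with hq
  have hqa : 0.1 * n ^ 2 ≤ a * (a - 1) := by nlinarith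
  have hqb : 0.1 * n ^ 2 ≤ b * (b - 1) := by nlinarith
  have hqc : 0.1 * n ^ 2 ≤ c * (c - 1) := by nlinarith
  have hbc : b * c ≤ 0.117 * n ^ 2 := by
    calc b * c ≤ (0.3408 * n) * (0.3408 * n) := by gcongr; linarith
      _ ≤ _ := by nlinarith
  have hsa : (s + d) * a ≤ 0.001 * n ^ 2 := by
    refine le_trans ?_ h1
    gcongr
    linarith
  have hss : s ^ 2 * n ≤ (s + d) ^ 2 * n := by
    gcongr
    linarith
  have hn2 : 0 ≤ n ^ 2 := sq_nonneg n
  have key : 0.06 * n ^ 2 ≤ q - 2 * (b * c) - 2 * ((s + d) * a) := by linarith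
  have key' : 1 * (0.06 * n ^ 2) ≤ d * (q - 2 * (b * c) - 2 * ((s + d) * a)) := by
    gcongr
  have hdd : 0 ≤ (s + d) * (d ^ 2 + d) := by positivity
  have e : 6 * ((a - d) * b * c +
      (s + d) * ((a - d) * (a - d - 1) / 2 + b * (b - 1) / 2 + c * (c - 1) / 2)) =
      6 * (a * b * c) + 3 * (s * q) + 3 * (d * (q - 2 * (b * c) - 2 * ((s + d) * a))) +
      3 * ((s + d) * (d ^ 2 + d)) := by
    rw [hq]; ring
  rw [e]
  linarith

lemma numeric_many_apices (hb : 0.318 * n ≤ b) (hc : 0.318 * n ≤ c) (ha : 0.318 * n ≤ a)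
    (hs : 0 ≤ s) (hd : 1 ≤ d) (hn : 1000 ≤ n)
    (h2 : (s + d) ^ 2 * n ≤ 0.001 * n ^ 2) :
    6 * (a * b * c) + 3 * (s * (a * (a - 1) + b * (b - 1) + c * (c - 1))) +
      3 * ((s + d) ^ 2 * n) ≤
    6 * ((a + d) * b * c +
      s * ((a + d) * (a + d - 1) / 2 + b * (b - 1) / 2 + c * (c - 1) / 2)) := by
  have hbc : 0.1 * n ^ 2 ≤ b * c := by
    calc 0.1 * n ^ 2 ≤ (0.318 * n) * (0.318 * n) := by nlinarith
      _ ≤ b * c := by gcongr; linarith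
  have hdbc : 1 * (0.1 * n ^ 2) ≤ d * (b * c) := by gcongr
  have h3 : 0 ≤ s * (d * (2 * a + d - 1)) := by
    have : 0 ≤ 2 * a + d - 1 := by linarith
    positivity
  nlinarith

lemma numeric_deficient (hb : 0.318 * n ≤ b) (hc : 0.318 * n ≤ c) (ha : 0.318 * n ≤ a)
    (hn : 1000 ≤ n) (h2 : s ^ 2 * n ≤ 0.001 * n ^ 2) :
    6 * (a * b * c) + 3 * ((s - 1) * (a * (a - 1) + b * (b - 1) + c * (c - 1)) + 2 * n) +
      3 * (s ^ 2 * n) ≤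
    6 * (a * b * c + s * (a * (a - 1) / 2 + b * (b - 1) / 2 + c * (c - 1) / 2)) := by
  have hqa : 0.1 * n ^ 2 ≤ a * (a - 1) := by nlinarith
  have hqb : 0.1 * n ^ 2 ≤ b * (b - 1) := by nlinarith
  have hqc : 0.1 * n ^ 2 ≤ c * (c - 1) := by nlinarith
  nlinarith

end Numerics

/-- The number of edges of the extremal construction, apart from those inside the set of apices. -/
def simCount (t a b c : ℕ) : ℕ := a * b * c + t * (a.choose 2 + b.choose 2 + c.choose 2)

lemma cast_simCount (t a b c : ℕ) : (simCount t a b c : ℝ) =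
    a * b * c + t * (a * (a - 1 : ℝ) / 2 + b * (b - 1 : ℝ) / 2 + c * (c - 1 : ℝ) / 2) := by
  rw [simCount]
  push_cast [Nat.cast_choose_two]
  ring

/-- A split triple system has at most as many edges as the extremal construction. -/
theorem IsSplit.exists_card_triples_le {V : Type*} [Fintype V] {E : V → V → V → Prop} {t : ℕ}
    {col : V → Fin 3} (h : IsSplit E t col) :
    ∃ a b c : ℕ, 0 < a ∧ 0 < b ∧ 0 < c ∧ a + b + c = Fintype.card V - t ∧
      #(triples E) ≤ 6 * (simCount t a b c + t.choose 3) := by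
  classical
  set n := Fintype.card V with hn
  set P := part (apices E) col with hP
  set X := apices E with hX
  have hL := h.large_real
  have hL' := h.large_real'
  have ht0 : (0 : ℝ) ≤ t := by positivity
  have hXR := h.card_apices_real
  have hle := h.card_part_le
  have hge := h.le_card_part
  rw [← hX, ← hP] at hle hge
  have ha := hge 0
  have hb := hge 1
  have hc := hge 2
  have ha' := hle 0
  have hb' := hle 1
  have hc' := hle 2
  have hsum := card_part X col
  rw [← hP] at hsum
  have hmono := card_monoPairs_le P
  have hmonoR : (#(monoPairs P) : ℝ) ≤ #(P 0) * (#(P 0) - 1 : ℝ) + #(P 1) * (#(P 1) - 1 : ℝ) +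
      #(P 2) * (#(P 2) - 1 : ℝ) := by
    have : (#(monoPairs P) : ℝ) ≤
      2 * ((#(P 0)).choose 2 + (#(P 1)).choose 2 + (#(P 2)).choose 2 : ℕ) := by exact_mod_cast hmono
    refine this.trans (le_of_eq ?_)
    push_cast [Nat.cast_choose_two]
    ring
  have hdouble := card_doubleTriples_le (E := E) X
  have hn1 : (1000 : ℝ) ≤ n := by linarith
  have hsq : ∀ r : ℝ, 0 ≤ r → r ≤ 10 * (t + 5) → r ^ 2 * n ≤ 0.001 * (n : ℝ) ^ 2 := by
    intro r hr0 hr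
    have h1 : r ^ 2 ≤ (10 * (t + 5)) ^ 2 := by gcongr
    nlinarith
  have hpos : ∀ i, 0 < #(P i) := by
    intro i
    have : (0 : ℝ) < #(P i) := by linarith [hge i]
    exact_mod_cast this
  rcases lt_trichotomy #X t with hlt | heq | hgt
  · obtain ⟨d, hd⟩ := Nat.exists_eq_add_of_lt hlt
    have hdt : (t : ℝ) = #X + (d + 1) := by rw [hd]; push_cast; ring
    have hdlt : d + 1 < #(P 0) := by
      have : (d : ℝ) + 1 < #(P 0) := by linarith
      exact_mod_cast this
    refine ⟨#(P 0) - (d + 1), #(P 1), #(P 2), by omega, hpos 1, hpos 2, by omega, ?_⟩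
    have h1 := h.card_triples_le_of_sum_le (h.sum_innerPairs_le' X)
    rw [← hP, ← hX] at h1
    have h2 : (#(triples E) : ℝ) ≤ 6 * (#(P 0) * #(P 1) * #(P 2)) + 3 * (#X * #(monoPairs P)) +
      3 * (#X ^ 2 * n) := by exact_mod_cast h1.trans (by gcongr)
    have h3 := numeric_few_apices (s := #X) (d := d + 1) ha ha' hb hb' hc hc' (by positivity)
      (by linarith [(by positivity : (0 : ℝ) ≤ d)]) hn1 (by rw [← hdt]; nlinarith)
      (by rw [← hdt]; exact hsq _ ht0 (by linarith))
    have h4 : (#X : ℝ) * #(monoPairs P) ≤ #X * (#(P 0) * (#(P 0) - 1 : ℝ) +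
      #(P 1) * (#(P 1) - 1 : ℝ) + #(P 2) * (#(P 2) - 1 : ℝ)) := by gcongr
    have h5 : (#(triples E) : ℝ) ≤ 6 * simCount t (#(P 0) - (d + 1)) #(P 1) #(P 2) := by
      rw [cast_simCount, Nat.cast_sub hdlt.le, hdt]
      push_cast
      linarith
    have h6 : #(triples E) ≤ 6 * simCount t (#(P 0) - (d + 1)) #(P 1) #(P 2) := by
      exact_mod_cast h5
    omega
  · refine ⟨#(P 0), #(P 1), #(P 2), hpos 0, hpos 1, hpos 2, by omega, ?_⟩
    by_cases hex : ∃ x y z, x ∈ X ∧ y ∈ X ∧ z ∉ X ∧ E x y z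
    · obtain ⟨x, y, z, hx, hy, hz, hxyz⟩ := hex
      have h1 := h.sum_innerPairs_le_of_edge hx hy hz hxyz
      have h2 := h.card_triples_le_of_sum_le le_rfl
      rw [← hP, ← hX] at h1 h2
      rw [heq] at h1 hdouble
      set I := ∑ v ∈ X, #(innerPairs E P v) with hI
      have h3 : (I : ℝ) + #(monoPairs P) ≤ t * #(monoPairs P) + 2 * n := by exact_mod_cast h1
      have h4 : (#(triples E) : ℝ) ≤ 6 * (#(P 0) * #(P 1) * #(P 2)) + 3 * I +
        3 * (t ^ 2 * n) := by exact_mod_cast h2.trans (by gcongr)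
      have h5 := numeric_deficient (s := t) hb hc ha hn1 (hsq _ ht0 (by linarith))
      have ht1 : (1 : ℝ) ≤ t := by
        have : 0 < #X := card_pos.mpr ⟨x, hx⟩
        rw [heq] at this
        exact_mod_cast this
      have h6 : ((t : ℝ) - 1) * #(monoPairs P) ≤ (t - 1) * (#(P 0) * (#(P 0) - 1 : ℝ) +
        #(P 1) * (#(P 1) - 1 : ℝ) + #(P 2) * (#(P 2) - 1 : ℝ)) := by
          have : (0 : ℝ) ≤ t - 1 := by linarith
          gcongr
      have h7 : (#(triples E) : ℝ) ≤ 6 * simCount t #(P 0) #(P 1) #(P 2) := by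
        rw [cast_simCount]
        linarith
      have h8 : #(triples E) ≤ 6 * simCount t #(P 0) #(P 1) #(P 2) := by exact_mod_cast h7
      omega
    · push Not at hex
      have hE := h.isTripleSystem
      have h1 : #(doubleTriples E X) ≤ 6 * (#X).choose 3 := by
        refine hE.card_le_choose_three fun q hq => ?_
        simp only [doubleTriples, mem_filter, mem_triples] at hq
        obtain ⟨hq, hq'⟩ := hq
        have h2 : ∀ x y z, x ∈ X → y ∈ X → E x y z → z ∈ X := by
          intro x y z hx hy hxyz
          by_contra hz
          exact hex x y z hx hy hz hxyz
        refine ⟨hq, ?_⟩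
        rcases hq' with h3 | h3 | h3
        · exact ⟨h3.1, h3.2, h2 _ _ _ h3.1 h3.2 hq⟩
        · exact ⟨h2 _ _ _ h3.1 h3.2 (hE.rot hq), h3.1, h3.2⟩
        · exact ⟨h3.2, h2 _ _ _ h3.1 h3.2 (hE.rot (hE.rot hq)), h3.1⟩
      rw [heq] at h1
      have h2 := h.card_triples_le_of_sum_le h.sum_innerPairs_le
      rw [← hP, ← hX] at h2
      have h3 : t * #(monoPairs P) ≤ t * (2 * ((#(P 0)).choose 2 + (#(P 1)).choose 2 +
        (#(P 2)).choose 2)) := by gcongr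
      rw [simCount]
      linarith
  · obtain ⟨d, hd⟩ := Nat.exists_eq_add_of_lt hgt
    have hdt : (#X : ℝ) = t + (d + 1) := by rw [hd]; push_cast; ring
    refine ⟨#(P 0) + (d + 1), #(P 1), #(P 2), by omega, hpos 1, hpos 2, by omega, ?_⟩
    have h1 := h.card_triples_le_of_sum_le h.sum_innerPairs_le
    rw [← hP, ← hX] at h1
    have h2 : (#(triples E) : ℝ) ≤ 6 * (#(P 0) * #(P 1) * #(P 2)) + 3 * (t * #(monoPairs P)) +
      3 * (#X ^ 2 * n) := by exact_mod_cast h1.trans (by gcongr)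
    have h3 := numeric_many_apices (s := t) (d := d + 1) hb hc ha ht0
      (by linarith [(by positivity : (0 : ℝ) ≤ d)]) hn1
      (by rw [← hdt]; exact hsq _ (by positivity) hXR)
    rw [← hdt] at h3
    have h4 : (t : ℝ) * #(monoPairs P) ≤ t * (#(P 0) * (#(P 0) - 1 : ℝ) +
      #(P 1) * (#(P 1) - 1 : ℝ) + #(P 2) * (#(P 2) - 1 : ℝ)) := by gcongr
    have h5 : (#(triples E) : ℝ) ≤ 6 * simCount t (#(P 0) + (d + 1)) #(P 1) #(P 2) := by
      rw [cast_simCount]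
      push_cast
      linarith
    have h6 : #(triples E) ≤ 6 * simCount t (#(P 0) + (d + 1)) #(P 1) #(P 2) := by
      exact_mod_cast h5
    omega

/-- A triple system of large minimum degree without a copy of `F_sim(t)` has at most as many edges
as the extremal construction. -/
theorem SimFree.exists_card_triples_le {V : Type*} [Fintype V] {E : V → V → V → Prop} {t : ℕ}
    (hE : IsTripleSystem E) (hS : SimFree E t)
    (hdeg : ∀ v, (2 / 9 - 1 / 20000) * (Fintype.card V : ℝ) ^ 2 ≤ #(link E v))
    (hn : 10 ^ 10 * (t + 5) ^ 2 ≤ Fintype.card V) :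
    ∃ a b c : ℕ, 0 < a ∧ 0 < b ∧ 0 < c ∧ a + b + c = Fintype.card V - t ∧
      #(triples E) ≤ 6 * (simCount t a b c + t.choose 3) := by
  have hn' : 10 ^ 10 * (t + 5) ≤ Fintype.card V := by nlinarith
  obtain ⟨col, h1, h2⟩ := hS.exists_coloring hE hdeg hn'
  have hsq : (0 : ℝ) ≤ (Fintype.card V : ℝ) ^ 2 := by positivity
  refine IsSplit.exists_card_triples_le (col := col) ⟨hE, hS, fun {x y z} => h1 x y z,
    fun {v} hv => le_trans ?_ (h2 v hv), fun v => le_trans ?_ (hdeg v),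
    hS.card_apices_le hE (fun v => le_trans ?_ (hdeg v)) (by omega), hn⟩
  all_goals gcongr; norm_num

section LowerBound

variable {V : Type*} [DecidableEq V]

/-- A totally symmetric ternary relation that holds for one ordering of a triple holds for all. -/
lemma of_triple_eq {r : V → V → V → Prop} (hrot : ∀ {x y z}, r x y z → r y z x)
    (hswap : ∀ {x y z}, r x y z → r y x z) {x y z x' y' z' : V} (hxyz : r x y z)
    (h : ({x', y', z'} : Finset V) = {x, y, z}) (hxy : x' ≠ y') (hyz : y' ≠ z') (hxz : x' ≠ z') :
    r x' y' z' := by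
  have hx : x' ∈ ({x, y, z} : Finset V) := by simp [← h]
  have hy : y' ∈ ({x, y, z} : Finset V) := by simp [← h]
  have hz : z' ∈ ({x, y, z} : Finset V) := by simp [← h]
  simp only [mem_insert, mem_singleton] at hx hy hz
  have h1 := hrot hxyz
  have h2 := hrot h1
  have h3 := hswap hxyz
  have h4 := hswap h1
  have h5 := hswap h2
  clear h
  rcases hx with rfl | rfl | rfl <;> rcases hy with rfl | rfl | rfl <;>
    rcases hz with rfl | rfl | rfl <;> first | assumption | contradiction

/-- The colour patterns of edges in the extremal construction; colour `3` is the set of apices. -/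
def IsPattern (i j k : Fin 4) : Prop :=
  (i ≠ j ∧ j ≠ k ∧ i ≠ k ∧ i ≠ 3 ∧ j ≠ 3 ∧ k ≠ 3) ∨ (i = 3 ∧ j = k) ∨ (j = 3 ∧ k = i) ∨
    (k = 3 ∧ i = j)

instance (i j k : Fin 4) : Decidable (IsPattern i j k) := inferInstanceAs (Decidable (_ ∨ _))

lemma IsPattern.rot : ∀ {i j k}, IsPattern i j k → IsPattern j k i := by decide

lemma IsPattern.swap : ∀ {i j k}, IsPattern i j k → IsPattern j i k := by decide

set_option maxRecDepth 100000 in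
lemma IsPattern.apex : ∀ {a b x y v}, IsPattern a b x → IsPattern a b y → IsPattern x y v →
    v = 3 := by decide

lemma IsPattern.eq_three : ∀ {p q z}, IsPattern 3 p q → IsPattern p q z → z = 3 := by decide

variable [Fintype V]

open scoped Classical in
/-- The 3-graph of all triples with an allowed colour pattern. -/
noncomputable def patternGraph (k : V → Fin 4) : Finset (Finset V) :=
  {e | ∃ x y z, x ≠ y ∧ y ≠ z ∧ x ≠ z ∧ e = {x, y, z} ∧ IsPattern (k x) (k y) (k z)}

lemma mem_patternGraph {k : V → Fin 4} {e : Finset V} : e ∈ patternGraph k ↔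
    ∃ x y z, x ≠ y ∧ y ≠ z ∧ x ≠ z ∧ e = {x, y, z} ∧ IsPattern (k x) (k y) (k z) := by
  simp [patternGraph]

lemma card_of_mem_patternGraph {k : V → Fin 4} {e : Finset V} (he : e ∈ patternGraph k) :
    #e = 3 := by
  obtain ⟨x, y, z, h1, h2, h3, rfl, -⟩ := mem_patternGraph.mp he
  exact card_eq_three.mpr ⟨x, y, z, h1, h3, h2, rfl⟩

lemma isPattern_of_mem {k : V → Fin 4} {x y z : V} (h : {x, y, z} ∈ patternGraph k)
    (hxy : x ≠ y) (hyz : y ≠ z) (hxz : x ≠ z) : IsPattern (k x) (k y) (k z) := by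
  obtain ⟨x', y', z', -, -, -, h1, h2⟩ := mem_patternGraph.mp h
  exact of_triple_eq (r := fun x y z => IsPattern (k x) (k y) (k z)) IsPattern.rot IsPattern.swap
    h2 h1 hxy hyz hxz

lemma not_hasCopy_patternGraph {k : V → Fin 4} {t : ℕ} (ht : #{v | k v = 3} ≤ t) :
    ¬ HasCopy (patternGraph k) (Fsim t) := by
  rintro ⟨f, hf⟩
  have hne : ∀ {i j}, i ≠ j → f i ≠ f j := fun h h' => h (f.injective h')
  have key : ∀ i j l, ({i, j, l} : Finset (Fin 7 ⊕ Fin t)) ∈ Fsim t → i ≠ j → j ≠ l → i ≠ l →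
      IsPattern (k (f i)) (k (f j)) (k (f l)) := by
    intro i j l h h1 h2 h3
    have h4 := hf _ h
    simp only [image_insert, image_singleton] at h4
    exact isPattern_of_mem h4 (hne h1) (hne h2) (hne h3)
  have h1 := key (.inl 0) (.inl 1) (.inl 2) (by simp [Fsim]) (by simp) (by simp) (by simp)
  have h2 := key (.inl 0) (.inl 1) (.inl 3) (by simp [Fsim]) (by simp) (by simp) (by simp)
  have h3 := key (.inl 2) (.inl 3) (.inl 4) (by simp [Fsim]) (by simp) (by simp) (by simp)
  have h4 := key (.inl 4) (.inl 5) (.inl 6) (by simp [Fsim]) (by simp) (by simp) (by simp)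
  have hv := h1.apex h2 h3
  rw [hv] at h4
  have h5 : ∀ j : Fin t, k (f (.inr j)) = 3 := fun j =>
    h4.eq_three (key (.inl 5) (.inl 6) (.inr j) (by simp [Fsim]) (by simp) (by simp) (by simp))
  have hsub : insert (f (.inl 4)) (univ.image fun j : Fin t => f (.inr j)) ⊆
      ({v | k v = 3} : Finset V) := by
    intro v hv'
    rw [mem_insert, mem_image] at hv'
    rcases hv' with rfl | ⟨j, -, rfl⟩
    · simpa using hv
    · simpa using h5 j
  have hc := card_le_card hsub
  rw [card_insert_of_notMem (by simp [f.injective.eq_iff]), card_image_of_injective _ (by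
    intro i j h; simpa using f.injective h), card_univ, Fintype.card_fin] at hc
  omega

lemma le_card_patternGraph (k : V → Fin 4) :
    simCount #{v | k v = 3} #{v | k v = 0} #{v | k v = 1} #{v | k v = 2} +
      (#{v | k v = 3}).choose 3 ≤ #(patternGraph k) := by
  set P : Fin 4 → Finset V := fun i => {v | k v = i} with hP
  have hmem : ∀ {v i}, v ∈ P i ↔ k v = i := by simp [hP]
  have hne : ∀ {x y i j}, k x = i → k y = j → i ≠ j → x ≠ y := by
    rintro x y i j rfl rfl h rfl
    exact h rfl
  have hdis : ∀ {i j}, i ≠ j → Disjoint ((P i).powersetCard 2) ((P j).powersetCard 2) := by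
    intro i j hij
    rw [Finset.disjoint_left]
    intro s hs hs'
    rw [mem_powersetCard] at hs hs'
    obtain ⟨v, hv⟩ := card_pos.mp (by omega : 0 < #s)
    exact hij ((hmem.mp (hs.1 hv)).symm.trans (hmem.mp (hs'.1 hv)))
  set T : Finset (Finset V) :=
    (P 0).powersetCard 2 ∪ (P 1).powersetCard 2 ∪ (P 2).powersetCard 2 with hT
  have hTc : #T = (#(P 0)).choose 2 + (#(P 1)).choose 2 + (#(P 2)).choose 2 := by
    rw [hT, card_union_of_disjoint (disjoint_union_left.mpr ⟨hdis (by decide), hdis (by decide)⟩),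
      card_union_of_disjoint (hdis (by decide))]
    simp only [card_powersetCard]
  have hTm : ∀ s ∈ T, #s = 2 ∧ ∃ i, i ≠ 3 ∧ s ⊆ P i := by
    intro s hs
    simp only [hT, mem_union, mem_powersetCard] at hs
    rcases hs with (h | h) | h
    exacts [⟨h.2, 0, by decide, h.1⟩, ⟨h.2, 1, by decide, h.1⟩, ⟨h.2, 2, by decide, h.1⟩]
  set H₁ := (P 0 ×ˢ P 1 ×ˢ P 2).image fun q => ({q.1, q.2.1, q.2.2} : Finset V) with hH₁
  set H₂ := (P 3 ×ˢ T).image fun q => insert q.1 q.2 with hH₂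
  set H₃ := (P 3).powersetCard 3 with hH₃
  have hc₁ : #H₁ = #(P 0) * #(P 1) * #(P 2) := by
    rw [hH₁, card_image_of_injOn, card_product, card_product, mul_assoc]
    rintro ⟨x, y, z⟩ hq ⟨x', y', z'⟩ hq' h
    simp only [coe_product, Set.mem_prod, mem_coe, hmem] at hq hq'
    simp only at h
    have hx : x ∈ ({x', y', z'} : Finset V) := by simp [← h]
    have hy : y ∈ ({x', y', z'} : Finset V) := by simp [← h]
    have hz : z ∈ ({x', y', z'} : Finset V) := by simp [← h]
    simp only [mem_insert, mem_singleton] at hx hy hz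
    have e1 : x = x' := by
      rcases hx with h | h | h
      exacts [h, absurd h (hne hq.1 hq'.2.1 (by decide)), absurd h (hne hq.1 hq'.2.2 (by decide))]
    have e2 : y = y' := by
      rcases hy with h | h | h
      exacts [absurd h (hne hq.2.1 hq'.1 (by decide)), h,
        absurd h (hne hq.2.1 hq'.2.2 (by decide))]
    have e3 : z = z' := by
      rcases hz with h | h | h
      exacts [absurd h (hne hq.2.2 hq'.1 (by decide)),
        absurd h (hne hq.2.2 hq'.2.1 (by decide)), h]
    rw [e1, e2, e3]
  have hnot : ∀ x ∈ P 3, ∀ s ∈ T, x ∉ s := by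
    intro x hx s hs hxs
    obtain ⟨-, i, hi, hsi⟩ := hTm s hs
    exact hi ((hmem.mp (hsi hxs)).symm.trans (hmem.mp hx))
  have hc₂ : #H₂ = #(P 3) * #T := by
    rw [hH₂, card_image_of_injOn, card_product]
    rintro ⟨x, s⟩ hq ⟨x', s'⟩ hq' h
    simp only [coe_product, Set.mem_prod, mem_coe] at hq hq'
    simp only at h
    have hx : x ∈ insert x' s' := by simp [← h]
    have e1 : x = x' := by
      rcases mem_insert.mp hx with h | h
      · exact h
      · exact absurd h (hnot x hq.1 s' hq'.2)
    subst e1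
    rw [← erase_insert (hnot x hq.1 s hq.2), h, erase_insert (hnot x hq.1 s' hq'.2)]
  have hd₁₂ : Disjoint H₁ H₂ := by
    rw [Finset.disjoint_left]
    intro e he he'
    obtain ⟨⟨x, y, z⟩, hq, rfl⟩ := mem_image.mp he
    obtain ⟨⟨w, s⟩, hq', h⟩ := mem_image.mp he'
    simp only [mem_product, hmem] at hq hq' h
    have hw : w ∈ ({x, y, z} : Finset V) := by simp [← h]
    simp only [mem_insert, mem_singleton] at hw
    rcases hw with h | h | h
    exacts [hne hq'.1 hq.1 (by decide) h, hne hq'.1 hq.2.1 (by decide) h,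
      hne hq'.1 hq.2.2 (by decide) h]
  have hd₃ : Disjoint (H₁ ∪ H₂) H₃ := by
    rw [Finset.disjoint_left]
    intro e he he'
    have he3 := (mem_powersetCard.mp he').1
    rcases mem_union.mp he with he | he
    · obtain ⟨⟨x, y, z⟩, hq, rfl⟩ := mem_image.mp he
      simp only [mem_product, hmem] at hq
      exact hne hq.1 (hmem.mp (he3 (mem_insert_self _ _))) (by decide) rfl
    · obtain ⟨⟨w, s⟩, hq, rfl⟩ := mem_image.mp he
      rw [mem_product] at hq
      obtain ⟨v, hv⟩ := card_pos.mp (by have := (hTm s hq.2).1; omega : 0 < #s)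
      exact hnot v (he3 (mem_insert_of_mem hv)) s hq.2 hv
  have hsub : H₁ ∪ H₂ ∪ H₃ ⊆ patternGraph k := by
    intro e he
    rw [mem_patternGraph]
    rcases mem_union.mp he with he | he
    · rcases mem_union.mp he with he | he
      · obtain ⟨⟨x, y, z⟩, hq, rfl⟩ := mem_image.mp he
        simp only [mem_product, hmem] at hq
        refine ⟨x, y, z, ?_, ?_, ?_, rfl, ?_⟩
        · exact hne hq.1 hq.2.1 (by decide)
        · exact hne hq.2.1 hq.2.2 (by decide)
        · exact hne hq.1 hq.2.2 (by decide)
        · rw [hq.1, hq.2.1, hq.2.2]; decide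
      · obtain ⟨⟨w, s⟩, hq, rfl⟩ := mem_image.mp he
        rw [mem_product] at hq
        have hws := hnot w hq.1 s hq.2
        obtain ⟨hs, i, hi, hsi⟩ := hTm s hq.2
        obtain ⟨x, y, hxy, rfl⟩ := card_eq_two.mp hs
        simp only [mem_insert, mem_singleton, not_or] at hws
        refine ⟨w, x, y, hws.1, hxy, hws.2, rfl, Or.inr (Or.inl ⟨hmem.mp hq.1, ?_⟩)⟩
        rw [hmem.mp (hsi (mem_insert_self _ _)),
          hmem.mp (hsi (mem_insert_of_mem (mem_singleton_self _)))]
    · obtain ⟨h1, h2⟩ := mem_powersetCard.mp he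
      obtain ⟨x, y, z, hxy, hxz, hyz, rfl⟩ := card_eq_three.mp h2
      refine ⟨x, y, z, hxy, hyz, hxz, rfl, Or.inr (Or.inl ⟨hmem.mp (h1 (mem_insert_self _ _)), ?_⟩)⟩
      rw [hmem.mp (h1 (by simp : y ∈ ({x, y, z} : Finset V))),
        hmem.mp (h1 (by simp : z ∈ ({x, y, z} : Finset V)))]
  refine le_trans (le_of_eq ?_) (card_le_card hsub)
  rw [card_union_of_disjoint hd₃, card_union_of_disjoint hd₁₂, hc₁, hc₂, hTc, hH₃,
    card_powersetCard, simCount]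

lemma exists_coloring_card {a b c t : ℕ} (h : a + b + c + t = Fintype.card V) :
    ∃ k : V → Fin 4, #{v | k v = 0} = a ∧ #{v | k v = 1} = b ∧ #{v | k v = 2} = c ∧
      #{v | k v = 3} = t := by
  obtain ⟨A, hA, hAc⟩ := exists_subset_card_eq (s := (univ : Finset V)) (n := a)
    (by rw [card_univ]; omega)
  obtain ⟨B, hB, hBc⟩ := exists_subset_card_eq (s := Aᶜ) (n := b) (by rw [card_compl]; omega)
  have hAB : #(A ∪ B) = a + b := by
    rw [card_union_of_disjoint (disjoint_compl_right.mono_right hB), hAc, hBc]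
  obtain ⟨C, hC, hCc⟩ := exists_subset_card_eq (s := (A ∪ B)ᶜ) (n := c)
    (by rw [card_compl]; omega)
  have hABC : #(A ∪ B ∪ C) = a + b + c := by
    rw [card_union_of_disjoint (disjoint_compl_right.mono_right hC), hAB, hCc]
  have hBA : ∀ v ∈ B, v ∉ A := fun v hv => mem_compl.mp (hB hv)
  have hCA : ∀ v ∈ C, v ∉ A ∧ v ∉ B := fun v hv => by
    simpa using hC hv
  refine ⟨fun v => if v ∈ A then 0 else if v ∈ B then 1 else if v ∈ C then 2 else 3, ?_, ?_, ?_, ?_⟩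
  · rw [← hAc]
    congr 1
    ext v
    by_cases h1 : v ∈ A <;> by_cases h2 : v ∈ B <;> by_cases h3 : v ∈ C <;> simp [h1, h2, h3]
  · rw [← hBc]
    congr 1
    ext v
    by_cases h1 : v ∈ A <;> by_cases h2 : v ∈ B <;> by_cases h3 : v ∈ C <;> simp [h1, h2, h3]
    exacts [hBA v h2 h1, hBA v h2 h1]
  · rw [← hCc]
    congr 1
    ext v
    by_cases h1 : v ∈ A <;> by_cases h2 : v ∈ B <;> by_cases h3 : v ∈ C <;> simp [h1, h2, h3]
    exacts [(hCA v h3).1 h1, (hCA v h3).1 h1, (hCA v h3).2 h2]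
  · have : ({v | (if v ∈ A then 0 else if v ∈ B then 1 else if v ∈ C then 2 else 3 : Fin 4) = 3} :
        Finset V) = (A ∪ B ∪ C)ᶜ := by
      ext v
      by_cases h1 : v ∈ A <;> by_cases h2 : v ∈ B <;> by_cases h3 : v ∈ C <;> simp [h1, h2, h3]
    rw [this, card_compl, hABC]
    omega

end LowerBound

section Bridge

variable {V : Type*} [DecidableEq V] {H : Finset (Finset V)} {t : ℕ}

/-- The symmetric ternary relation of a 3-graph. -/
def rel (H : Finset (Finset V)) (x y z : V) : Prop := ({x, y, z} : Finset V) ∈ H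

lemma triple_rot (x y z : V) : ({y, z, x} : Finset V) = {x, y, z} := by
  rw [pair_comm z x, insert_comm]

lemma isTripleSystem_rel (h3 : ∀ e ∈ H, #e = 3) : IsTripleSystem (rel H) where
  rot {x y z} h := by rwa [rel, triple_rot]
  swap {x y z} h := by rwa [rel, insert_comm]
  ne {x y z} h := by
    rintro rfl
    have h1 := h3 _ h
    rw [insert_eq_of_mem (mem_insert_self _ _)] at h1
    have := card_le_two (a := x) (b := z)
    omega

lemma simFree_rel (h3 : ∀ e ∈ H, #e = 3) (hH : ¬ HasCopy H (Fsim t)) : SimFree (rel H) t := by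
  intro u w x y v p q h1 h2 h4 hvu hvw h5 hp hq S hS
  by_contra! hc
  have hE := isTripleSystem_rel h3
  have n1 := hE.ne h1
  have n2 := hE.ne' h1
  have n3 := hE.ne'' h1
  have n4 := hE.ne' h2
  have n5 := hE.ne'' h2
  have n6 := hE.ne h4
  have n7 := hE.ne' h4
  have n8 := hE.ne'' h4
  have n9 := hE.ne h5
  have n10 := hE.ne' h5
  have n11 := hE.ne'' h5
  obtain ⟨hp1, hp2, hp3, hp4⟩ := hp
  obtain ⟨hq1, hq2, hq3, hq4⟩ := hq
  obtain ⟨g⟩ : Nonempty (Fin t ↪ S) := Function.Embedding.nonempty_of_card_le (by simpa using hc)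
  have hinj : Function.Injective ![u, w, x, y, v, p, q] := by
    rw [← List.nodup_ofFn]
    simp [List.ofFn_succ]
    grind
  have hg : ∀ j, rel H p q (g j) ∧ (g j : V) ≠ u ∧ (g j : V) ≠ w ∧ (g j : V) ≠ x ∧
      (g j : V) ≠ y ∧ (g j : V) ≠ v ∧ (g j : V) ≠ p ∧ (g j : V) ≠ q := by
    intro j
    obtain ⟨m1, m2, m3, m4, m5, m6⟩ := hS _ (g j).2
    have := hE.ne' m1
    have := hE.ne'' m1
    exact ⟨m1, m2, m3, m4, m5, m6, by grind, by grind⟩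
  refine hH ⟨⟨Sum.elim ![u, w, x, y, v, p, q] fun j => (g j : V), hinj.sumElim
    (fun i j h => g.injective (Subtype.ext h)) ?_⟩, ?_⟩
  · intro i j h
    obtain ⟨-, m2, m3, m4, m5, m6, m7, m8⟩ := hg j
    fin_cases i <;> simp at h <;> grind
  · intro e he
    simp only [Fsim, mem_union, mem_insert, mem_singleton, mem_image, mem_univ, true_and] at he
    rcases he with (rfl | rfl | rfl | rfl) | ⟨j, rfl⟩
    · simpa [rel] using h1
    · simpa [rel] using h2
    · simpa [rel] using h4
    · simpa [rel] using h5
    · simpa [rel] using (hg j).1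

variable [Fintype V]

lemma six_mul_card_le (h3 : ∀ e ∈ H, #e = 3) : 6 * #H ≤ #(triples (rel H)) := by
  rw [card_eq_sum_card_fiberwise (f := fun q => ({q.1, q.2.1, q.2.2} : Finset V)) (t := H)
    (fun q hq => mem_triples.mp hq), mul_comm, ← smul_eq_mul]
  refine card_nsmul_le_sum _ _ _ fun e he => ?_
  obtain ⟨x, y, z, hxy, hxz, hyz, rfl⟩ := card_eq_three.mp (h3 e he)
  have h1 : #({(x, y, z), (y, z, x), (z, x, y), (y, x, z), (x, z, y), (z, y, x)} :
      Finset (V × V × V)) = 6 := by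
    simp [hxy, hxz, hyz, hxy.symm, hxz.symm, hyz.symm, card_insert_of_notMem]
  rw [← h1]
  refine card_le_card fun q hq => ?_
  have hE := isTripleSystem_rel h3
  have h2 : rel H x y z := he
  have key : rel H q.1 q.2.1 q.2.2 ∧ ({q.1, q.2.1, q.2.2} : Finset V) = {x, y, z} := by
    simp only [mem_insert, mem_singleton] at hq
    rcases hq with rfl | rfl | rfl | rfl | rfl | rfl
    · exact ⟨h2, rfl⟩
    · exact ⟨hE.rot h2, triple_rot x y z⟩
    · exact ⟨hE.rot (hE.rot h2), (triple_rot y z x).trans (triple_rot x y z)⟩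
    · exact ⟨hE.swap h2, insert_comm _ _ _⟩
    · exact ⟨hE.swap' h2, by rw [pair_comm]⟩
    · exact ⟨hE.swap (hE.rot h2), (insert_comm _ _ _).trans (triple_rot x y z)⟩
  rw [mem_filter, mem_triples]
  exact key

lemma two_mul_degree_le (h3 : ∀ e ∈ H, #e = 3) (v : V) :
    2 * #{e ∈ H | v ∈ e} ≤ #(link (rel H) v) := by
  rw [card_eq_sum_card_fiberwise (f := fun q : V × V => ({v, q.1, q.2} : Finset V)) (t := {e ∈ H | v ∈ e})
    (fun q hq => by
      have : rel H v q.1 q.2 := by simpa [link] using hq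
      simpa [rel] using this), mul_comm, ← smul_eq_mul]
  refine card_nsmul_le_sum _ _ _ fun e he => ?_
  obtain ⟨he, hv⟩ := mem_filter.mp he
  obtain ⟨y, z, hyz, h1⟩ := card_eq_two.mp (by rw [card_erase_of_mem hv, h3 e he] : #(e.erase v) = 2)
  obtain rfl : e = {v, y, z} := by rw [← insert_erase hv, h1]
  have h2 : rel H v y z := he
  rw [← card_pair (a := (y, z)) (b := (z, y)) (by simp [hyz])]
  refine card_le_card fun q hq => ?_
  rw [mem_filter]
  simp only [mem_insert, mem_singleton] at hq
  rcases hq with rfl | rfl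
  · exact ⟨by simpa [link] using h2, rfl⟩
  · exact ⟨by simpa [link] using (isTripleSystem_rel h3).swap' h2, by rw [pair_comm]⟩

end Bridge

section Extremal

/-- The set whose supremum, up to the additive constant `C(t,3)`, is the Turán number. -/
def simValues (t n : ℕ) : Set ℕ :=
  {k | ∃ a b c : ℕ, 0 < a ∧ 0 < b ∧ 0 < c ∧ a + b + c = n - t ∧
    k = a * b * c + t * (a.choose 2 + b.choose 2 + c.choose 2)}

lemma bddAbove_simValues (t n : ℕ) : BddAbove (simValues t n) := by
  refine ⟨n * n * n + t * (n.choose 2 + n.choose 2 + n.choose 2), ?_⟩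
  rintro _ ⟨a, b, c, -, -, -, h, rfl⟩
  have ha : a ≤ n := by omega
  have hb : b ≤ n := by omega
  have hc : c ≤ n := by omega
  gcongr

lemma simCount_le_sSup {t n a b c : ℕ} (ha : 0 < a) (hb : 0 < b) (hc : 0 < c)
    (h : a + b + c = n - t) : simCount t a b c ≤ sSup (simValues t n) :=
  le_csSup (bddAbove_simValues t n) ⟨a, b, c, ha, hb, hc, h, rfl⟩

lemma exists_simCount_eq_sSup {t n : ℕ} (hn : t + 3 ≤ n) : ∃ a b c, 0 < a ∧ 0 < b ∧ 0 < c ∧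
    a + b + c = n - t ∧ simCount t a b c = sSup (simValues t n) := by
  have hne : (simValues t n).Nonempty :=
    ⟨_, 1, 1, n - t - 2, one_pos, one_pos, by omega, by omega, rfl⟩
  obtain ⟨a, b, c, ha, hb, hc, h, hk⟩ := Nat.sSup_mem hne (bddAbove_simValues t n)
  exact ⟨a, b, c, ha, hb, hc, h, hk.symm⟩

lemma numeric_increment {a b c s N k v m : ℝ} (ha : 0 ≤ a) (hb : 0 ≤ b) (hc : 0 ≤ c)
    (hs : 1 ≤ s) (hN : 10 ^ 7 * s ≤ N) (habc : a + b + c = N) (hk : (N - 2) / 3 ≤ k)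
    (hv : k ^ 3 ≤ v) (hv' : v ≤ a * b * c + s * N ^ 2)
    (hm : m = (1 / 9 - 1 / 50000) * (N + s) ^ 2) :
    m ≤ b * c ∨ m ≤ c * a ∨ m ≤ a * b := by
  by_contra! h
  obtain ⟨h1, h2, h3⟩ := h
  have e1 : 3 * (a * b * c) ≤ m * N := by
    rw [← habc]
    nlinarith [mul_le_mul_of_nonneg_left h1.le ha, mul_le_mul_of_nonneg_left h2.le hb,
      mul_le_mul_of_nonneg_left h3.le hc]
  have hN0 : 0 < N := by linarith
  have e2 : ((N - 2) / 3) ^ 3 ≤ k ^ 3 := pow_le_pow_left₀ (by linarith) hk 3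
  have e3 : 10 ^ 7 * (s * N ^ 2) ≤ N ^ 3 := by nlinarith [mul_le_mul_of_nonneg_right hN (sq_nonneg N)]
  have e4 : s ^ 2 * N ≤ s * N ^ 2 := by
    have : s * N * s ≤ s * N * N := by gcongr; linarith
    linarith
  have e5 : N ^ 2 ≤ s * N ^ 2 := le_mul_of_one_le_left (sq_nonneg N) hs
  have e6 : 0 ≤ s ^ 2 * N := by positivity
  have e7 : 0 < N ^ 3 := by positivity
  rw [hm] at e1
  nlinarith

lemma sSup_simValues_add_le {t n : ℕ} (hn : 10 ^ 8 * (t + 1) ≤ n) :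
    ((sSup (simValues t n) : ℕ) : ℝ) + (1 / 9 - 1 / 50000) * ((n : ℝ) + 1) ^ 2 ≤
      (sSup (simValues t (n + 1)) : ℕ) := by
  obtain ⟨a, b, c, ha, hb, hc, h, hv⟩ := exists_simCount_eq_sSup (t := t) (n := n) (by omega)
  obtain ⟨N, rfl⟩ : ∃ N, n = N + t := ⟨n - t, by omega⟩
  rw [Nat.add_sub_cancel] at h
  have hk : (N / 3) ^ 3 ≤ simCount t a b c := by
    rw [hv]
    refine le_trans ?_ (simCount_le_sSup (a := N / 3) (b := N / 3) (c := N - 2 * (N / 3))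
      (by omega) (by omega) (by omega) (by omega))
    have h1 : N / 3 * (N / 3) * (N / 3) ≤ N / 3 * (N / 3) * (N - 2 * (N / 3)) := by
      gcongr
      omega
    rw [simCount]
    nlinarith
  have hv' : (simCount t a b c : ℝ) ≤ a * b * c + (t + 1) * N ^ 2 := by
    rw [cast_simCount, ← h]
    push_cast
    have ha0 : (0 : ℝ) ≤ a := by positivity
    have hb0 : (0 : ℝ) ≤ b := by positivity
    have hc0 : (0 : ℝ) ≤ c := by positivity
    have h1 : (a * (a - 1 : ℝ) / 2 + b * (b - 1 : ℝ) / 2 + c * (c - 1 : ℝ) / 2) ≤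
        ((a : ℝ) + b + c) ^ 2 := by
      nlinarith [mul_nonneg ha0 hb0, mul_nonneg ha0 hc0, mul_nonneg hb0 hc0]
    have h2 : (t : ℝ) * (a * (a - 1 : ℝ) / 2 + b * (b - 1 : ℝ) / 2 + c * (c - 1 : ℝ) / 2) ≤
      t * ((a : ℝ) + b + c) ^ 2 := by gcongr
    nlinarith [sq_nonneg ((a : ℝ) + b + c)]
  have hinc := numeric_increment (a := a) (b := b) (c := c) (s := t + 1) (N := N)
    (k := (N / 3 : ℕ)) (v := simCount t a b c) (by positivity) (by positivity) (by positivity)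
    (by linarith [(by positivity : (0 : ℝ) ≤ t)])
    (by have : 10 ^ 7 * (t + 1) ≤ N := by omega
        exact_mod_cast this) (by exact_mod_cast h)
    (by have : N ≤ 3 * (N / 3) + 2 := by omega
        have : (N : ℝ) ≤ 3 * (N / 3 : ℕ) + 2 := by exact_mod_cast this
        linarith) (by exact_mod_cast hk) hv' rfl
  have hsucc : ∀ x : ℕ, (x + 1).choose 2 = x + x.choose 2 := fun x => by
    rw [Nat.choose_succ_succ', Nat.choose_one_right]
  have key : ∀ d : ℕ, simCount t a b c + d ≤ sSup (simValues t (N + t + 1)) →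
      (1 / 9 - 1 / 50000 : ℝ) * (N + (t + 1)) ^ 2 ≤ d →
      ((sSup (simValues t (N + t)) : ℕ) : ℝ) + (1 / 9 - 1 / 50000) * (((N + t : ℕ) : ℝ) + 1) ^ 2 ≤
        (sSup (simValues t (N + t + 1)) : ℕ) := by
    intro d h1 h2
    have h3 : (simCount t a b c : ℝ) + d ≤ (sSup (simValues t (N + t + 1)) : ℕ) := by
      exact_mod_cast h1
    rw [← hv]
    push_cast
    rw [add_assoc (N : ℝ)]
    linarith
  rcases hinc with h1 | h1 | h1
  · refine key (b * c) ?_ (by exact_mod_cast h1)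
    refine le_trans ?_ (simCount_le_sSup (a := a + 1) (b := b) (c := c) (by omega) hb hc (by omega))
    rw [simCount, simCount, hsucc]
    nlinarith
  · refine key (c * a) ?_ (by exact_mod_cast h1)
    refine le_trans ?_ (simCount_le_sSup (a := a) (b := b + 1) (c := c) ha (by omega) hc (by omega))
    rw [simCount, simCount, hsucc]
    nlinarith
  · refine key (a * b) ?_ (by exact_mod_cast h1)
    refine le_trans ?_ (simCount_le_sSup (a := a) (b := b) (c := c + 1) ha hb (by omega) (by omega))
    rw [simCount, simCount, hsucc]
    nlinarith

end Extremal

section Deletion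

variable {n : ℕ}

/-- The 3-graph obtained by deleting the vertex `v`. -/
def deleteVertex (H : Finset (Finset (Fin (n + 1)))) (v : Fin (n + 1)) : Finset (Finset (Fin n)) :=
  {e | e.map v.succAboveEmb ∈ H}

lemma mem_deleteVertex {H : Finset (Finset (Fin (n + 1)))} {v : Fin (n + 1)}
    {e : Finset (Fin n)} : e ∈ deleteVertex H v ↔ e.map v.succAboveEmb ∈ H := by
  simp [deleteVertex]

lemma card_le_card_deleteVertex_add (H : Finset (Finset (Fin (n + 1)))) (v : Fin (n + 1)) :
    #H ≤ #(deleteVertex H v) + #{e ∈ H | v ∈ e} := by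
  rw [← card_filter_add_card_filter_not (s := H) (v ∈ ·), add_comm]
  refine Nat.add_le_add_right ?_ _
  rw [← card_map (mapEmbedding v.succAboveEmb).toEmbedding (s := deleteVertex H v)]
  refine card_le_card fun e he => ?_
  obtain ⟨he, hv⟩ := mem_filter.mp he
  have h1 : ((univ.filter fun x => v.succAbove x ∈ e).map v.succAboveEmb) = e := by
    ext y
    simp only [mem_map, mem_filter, mem_univ, true_and, Fin.succAboveEmb_apply]
    constructor
    · rintro ⟨x, hx, rfl⟩
      exact hx
    · intro hy
      obtain ⟨x, rfl⟩ := Fin.exists_succAbove_eq (x := y) (y := v) (by rintro rfl; exact hv hy)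
      exact ⟨x, hy, rfl⟩
  rw [mem_map]
  exact ⟨univ.filter fun x => v.succAbove x ∈ e, mem_deleteVertex.mpr (by rwa [h1]), h1⟩

lemma not_hasCopy_deleteVertex {W : Type*} [DecidableEq W] {F : Finset (Finset W)}
    {H : Finset (Finset (Fin (n + 1)))} (hH : ¬ HasCopy H F) (v : Fin (n + 1)) :
    ¬ HasCopy (deleteVertex H v) F := by
  rintro ⟨f, hf⟩
  refine hH ⟨f.trans v.succAboveEmb, fun e he => ?_⟩
  have h1 := mem_deleteVertex.mp (hf e he)
  rw [map_eq_image, image_image] at h1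
  exact h1

end Deletion

section Turan

lemma card_le_of_min_degree {t n : ℕ} (hn : 10 ^ 10 * (t + 5) ^ 2 ≤ n)
    {H : Finset (Finset (Fin n))} (h3 : ∀ e ∈ H, #e = 3) (hH : ¬ HasCopy H (Fsim t))
    (hdeg : ∀ v, (1 / 9 - 1 / 40000) * (n : ℝ) ^ 2 ≤ #{e ∈ H | v ∈ e}) :
    #H ≤ sSup (simValues t n) + t.choose 3 := by
  obtain ⟨a, b, c, ha, hb, hc, h, hle⟩ := (simFree_rel h3 hH).exists_card_triples_le
    (isTripleSystem_rel h3) (fun v => by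
      have h1 : (2 : ℝ) * #{e ∈ H | v ∈ e} ≤ #(link (rel H) v) := by
        exact_mod_cast two_mul_degree_le h3 v
      rw [Fintype.card_fin]
      linarith [hdeg v]) (by rwa [Fintype.card_fin])
  rw [Fintype.card_fin] at h
  have h1 := six_mul_card_le h3
  have h2 := simCount_le_sSup ha hb hc h
  omega

lemma card_le_add_of_le {t N : ℕ} (hN : 10 ^ 10 * (t + 5) ^ 2 ≤ N) (j : ℕ)
    {H : Finset (Finset (Fin (N + j)))} (h3 : ∀ e ∈ H, #e = 3) (hH : ¬ HasCopy H (Fsim t)) :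
    #H ≤ sSup (simValues t (N + j)) + t.choose 3 + (Fintype.card (Finset (Finset (Fin N))) - j) := by
  induction j with
  | zero =>
    have h1 : #H ≤ Fintype.card (Finset (Fin N)) := card_le_univ H
    have h2 : Fintype.card (Finset (Fin N)) ≤ Fintype.card (Finset (Finset (Fin N))) :=
      Fintype.card_le_of_injective _ (singleton_injective (α := Finset (Fin N)))
    omega
  | succ j ih =>
    by_cases hdeg : ∀ v, (1 / 9 - 1 / 40000) * ((N + (j + 1) : ℕ) : ℝ) ^ 2 ≤ #{e ∈ H | v ∈ e}
    · exact (card_le_of_min_degree (by omega) h3 hH hdeg).trans (Nat.le_add_right _ _)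
    push Not at hdeg
    obtain ⟨v, hv⟩ := hdeg
    have h1 : #H ≤ #(deleteVertex H v) + #{e ∈ H | v ∈ e} := card_le_card_deleteVertex_add H v
    have h2 := ih (H := deleteVertex H v)
      (fun e he => by rw [← h3 _ (mem_deleteVertex.mp he), card_map])
      (not_hasCopy_deleteVertex hH v)
    have hbig : 10 ^ 8 * (t + 1) ≤ N + j := by nlinarith
    have h4 := sSup_simValues_add_le hbig
    have h5 : (10 : ℝ) ^ 8 ≤ ((N + j : ℕ) : ℝ) := by
      have : 10 ^ 8 ≤ N + j := by omega
      exact_mod_cast this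
    have h6 : ((sSup (simValues t (N + j)) : ℕ) : ℝ) + #{e ∈ H | v ∈ e} + 1 ≤
        (sSup (simValues t (N + j + 1)) : ℕ) := by
      have h7 : ((N + (j + 1) : ℕ) : ℝ) = ((N + j : ℕ) : ℝ) + 1 := by push_cast; ring
      rw [h7] at hv
      nlinarith
    have h7 : sSup (simValues t (N + j)) + #{e ∈ H | v ∈ e} + 1 ≤
        sSup (simValues t (N + j + 1)) := by exact_mod_cast h6
    change #H ≤ sSup (simValues t (N + j + 1)) + _ + _
    omega

lemma exists_card_eq_of_le {t n : ℕ} (hn : t + 3 ≤ n) : ∃ H : Finset (Finset (Fin n)),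
    (∀ e ∈ H, #e = 3) ∧ ¬ HasCopy H (Fsim t) ∧ sSup (simValues t n) + t.choose 3 ≤ #H := by
  obtain ⟨a, b, c, -, -, -, h, hv⟩ := exists_simCount_eq_sSup hn
  obtain ⟨k, h0, h1, h2, h3⟩ := exists_coloring_card (V := Fin n) (a := a) (b := b) (c := c)
    (t := t) (by rw [Fintype.card_fin]; omega)
  refine ⟨patternGraph k, fun e he => card_of_mem_patternGraph he,
    not_hasCopy_patternGraph h3.le, ?_⟩
  have h4 := le_card_patternGraph k
  rwa [h0, h1, h2, h3, hv] at h4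

end Turan

theorem statement6 (t : ℕ) (ht : 1 ≤ t) :
    ∃ n0 : ℕ, ∀ n : ℕ, n ≥ n0 →
    exThree n (Fsim t) =
      sSup {k | ∃ a b c : ℕ, 0 < a ∧ 0 < b ∧ 0 < c ∧ a + b + c = n - t ∧
        k = a*b*c + t*(a.choose 2 + b.choose 2 + c.choose 2)} + t.choose 3 := by
  obtain ⟨N, hN⟩ : ∃ N, N = 10 ^ 10 * (t + 5) ^ 2 := ⟨_, rfl⟩
  refine ⟨N + Fintype.card (Finset (Finset (Fin N))), fun n hn => ?_⟩
  change exThree n (Fsim t) = sSup (simValues t n) + t.choose 3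
  have hle : ∀ k ∈ {k | ∃ H : Finset (Finset (Fin n)), (∀ e ∈ H, e.card = 3) ∧
      ¬ HasCopy H (Fsim t) ∧ H.card = k}, k ≤ sSup (simValues t n) + t.choose 3 := by
    rintro _ ⟨H, h3, hH, rfl⟩
    obtain ⟨j, rfl⟩ := Nat.exists_eq_add_of_le (le_trans (Nat.le_add_right _ _) hn)
    have h1 := card_le_add_of_le hN.ge j h3 hH
    rwa [Nat.sub_eq_zero_of_le (by omega), add_zero] at h1
  have htn : t + 3 ≤ n := by nlinarith
  obtain ⟨H, h3, hH, hcard⟩ := exists_card_eq_of_le htn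
  exact le_antisymm (csSup_le' hle) (hcard.trans (le_csSup ⟨_, hle⟩ ⟨H, h3, hH, rfl⟩))
end

section
/- Let t ≥ 1 and let a, b, c be positive integers with a + b + c = n − t. Let H be the n-vertex 3-graph obtained as follows: take the complete 3-partite 3-graph with parts A, B, C of sizes a, b, c (hyperedges are the triples with one vertex in each part), add a set X of t further vertices, and add as hyperedges all 3-subsets of X and all triples consisting of one vertex of X together with two vertices lying in a common part among A, B, C. Then, for n sufficiently large (given t), H is F_sim(t)-free, and H has exactly abc + t(C(a,2) + C(b,2) + C(c,2)) + C(t,3) hyperedges. -/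
open Finset

/-- The number of sets meeting the blocks of a partition into four parts in prescribed
cardinalities. -/
theorem card_filter_card_inter_eq {V : Type*} [Fintype V] [DecidableEq V] {A B C X : Finset V}
    (hAB : Disjoint A B) (hAC : Disjoint A C) (hAX : Disjoint A X)
    (hBC : Disjoint B C) (hBX : Disjoint B X) (hCX : Disjoint C X)
    (hU : A ∪ B ∪ C ∪ X = univ) (i j k l : ℕ) :
    #{e : Finset V | #(e ∩ A) = i ∧ #(e ∩ B) = j ∧ #(e ∩ C) = k ∧ #(e ∩ X) = l} =
      (#A).choose i * ((#B).choose j * ((#C).choose k * (#X).choose l)) := by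
  rw [← card_powersetCard, ← card_powersetCard, ← card_powersetCard, ← card_powersetCard,
    ← card_product, ← card_product, ← card_product]
  refine card_nbij' (fun e => (e ∩ A, e ∩ B, e ∩ C, e ∩ X))
    (fun p => p.1 ∪ p.2.1 ∪ p.2.2.1 ∪ p.2.2.2) ?_ ?_ ?_ ?_
  · intro e he
    simpa [mem_powersetCard] using he
  · rintro ⟨P, Q, R, S⟩ h
    simp only [coe_product, Set.mem_prod, mem_coe, mem_powersetCard] at h
    obtain ⟨⟨hP, rfl⟩, ⟨hQ, rfl⟩, ⟨hR, rfl⟩, hS, rfl⟩ := h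
    simp only [coe_filter, mem_univ, true_and, Set.mem_ofPred_eq]
    simp only [disjoint_left, subset_iff] at *
    refine ⟨?_, ?_, ?_, ?_⟩ <;> congr 1 <;> ext v <;> simp only [mem_inter, mem_union] <;> grind
  · intro e _
    simp only [← inter_union_distrib_left, hU, inter_univ]
  · rintro ⟨P, Q, R, S⟩ h
    simp only [coe_product, Set.mem_prod, mem_coe, mem_powersetCard] at h
    obtain ⟨⟨hP, -⟩, ⟨hQ, -⟩, ⟨hR, -⟩, hS, -⟩ := h
    simp only [disjoint_left, subset_iff] at *
    simp only [Prod.mk.injEq]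
    refine ⟨?_, ?_, ?_, ?_⟩ <;> ext v <;> simp only [mem_inter, mem_union] <;> grind

theorem card_eq_sum_card_inter {V : Type*} [Fintype V] [DecidableEq V] {A B C X : Finset V}
    (hAB : Disjoint A B) (hAC : Disjoint A C) (hAX : Disjoint A X)
    (hBC : Disjoint B C) (hBX : Disjoint B X) (hCX : Disjoint C X)
    (hU : A ∪ B ∪ C ∪ X = univ) (e : Finset V) :
    #e = #(e ∩ A) + #(e ∩ B) + #(e ∩ C) + #(e ∩ X) := by
  have hd {P Q : Finset V} (h : Disjoint P Q) : Disjoint (e ∩ P) (e ∩ Q) :=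
    h.mono inter_subset_right inter_subset_right
  rw [← card_union_of_disjoint (hd hAB), ← card_union_of_disjoint, ← card_union_of_disjoint,
    ← inter_union_distrib_left, ← inter_union_distrib_left, ← inter_union_distrib_left, hU,
    inter_univ]
  · simp only [disjoint_union_left]
    exact ⟨⟨hd hAX, hd hBX⟩, hd hCX⟩
  · simp only [disjoint_union_left]
    exact ⟨hd hAC, hd hBC⟩

/-- The hyperedges of `simConstr n A B C X`, described by the number of their vertices in each
part. -/
theorem mem_simConstr_iff {n : ℕ} {A B C X : Finset (Fin n)}
    (hAB : Disjoint A B) (hAC : Disjoint A C) (hAX : Disjoint A X)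
    (hBC : Disjoint B C) (hBX : Disjoint B X) (hCX : Disjoint C X)
    (hU : A ∪ B ∪ C ∪ X = univ) (e : Finset (Fin n)) :
    e ∈ simConstr n A B C X ↔
      (#(e ∩ A) = 1 ∧ #(e ∩ B) = 1 ∧ #(e ∩ C) = 1 ∧ #(e ∩ X) = 0) ∨
      (#(e ∩ A) = 2 ∧ #(e ∩ B) = 0 ∧ #(e ∩ C) = 0 ∧ #(e ∩ X) = 1) ∨
      (#(e ∩ A) = 0 ∧ #(e ∩ B) = 2 ∧ #(e ∩ C) = 0 ∧ #(e ∩ X) = 1) ∨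
      (#(e ∩ A) = 0 ∧ #(e ∩ B) = 0 ∧ #(e ∩ C) = 2 ∧ #(e ∩ X) = 1) ∨
      (#(e ∩ A) = 0 ∧ #(e ∩ B) = 0 ∧ #(e ∩ C) = 0 ∧ #(e ∩ X) = 3) := by
  have hcard := card_eq_sum_card_inter hAB hAC hAX hBC hBX hCX hU e
  have hsub : e ⊆ X ↔ #(e ∩ X) = #e :=
    ⟨fun h => by rw [inter_eq_left.2 h],
      fun h => inter_eq_left.1 (eq_of_subset_of_card_le inter_subset_left h.ge)⟩
  simp only [simConstr, mem_filter, mem_univ, true_and, hsub]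
  omega

theorem card_simConstr {n : ℕ} {A B C X : Finset (Fin n)}
    (hAB : Disjoint A B) (hAC : Disjoint A C) (hAX : Disjoint A X)
    (hBC : Disjoint B C) (hBX : Disjoint B X) (hCX : Disjoint C X)
    (hU : A ∪ B ∪ C ∪ X = univ) :
    #(simConstr n A B C X) =
      #A * #B * #C + #X * ((#A).choose 2 + (#B).choose 2 + (#C).choose 2) + (#X).choose 3 := by
  have hcount := card_filter_card_inter_eq hAB hAC hAX hBC hBX hCX hU
  have heq : simConstr n A B C X = univ.filter _ :=
    (filter_univ_mem _).symm.trans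
      (filter_congr fun e _ => mem_simConstr_iff hAB hAC hAX hBC hBX hCX hU e)
  rw [heq, filter_or, card_union_of_disjoint, filter_or, card_union_of_disjoint, filter_or,
    card_union_of_disjoint, filter_or, card_union_of_disjoint, hcount, hcount, hcount, hcount,
    hcount]
  · simp only [Nat.choose_one_right, Nat.choose_zero_right]
    ring
  all_goals
    rw [disjoint_filter]
    intro e _
    omega

/-- Every hyperedge of `simConstr n A B C X` meets both `A ∪ C` and `B ∪ C` in an even number of
vertices. -/
theorem even_card_inter_of_mem_simConstr {n : ℕ} {A B C X : Finset (Fin n)}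
    (hAB : Disjoint A B) (hAC : Disjoint A C) (hAX : Disjoint A X)
    (hBC : Disjoint B C) (hBX : Disjoint B X) (hCX : Disjoint C X)
    (hU : A ∪ B ∪ C ∪ X = univ) {e : Finset (Fin n)} (he : e ∈ simConstr n A B C X) :
    Even #(e ∩ (A ∪ C)) ∧ Even #(e ∩ (B ∪ C)) := by
  have hd {P Q : Finset (Fin n)} (h : Disjoint P Q) : Disjoint (e ∩ P) (e ∩ Q) :=
    h.mono inter_subset_right inter_subset_right
  rw [mem_simConstr_iff hAB hAC hAX hBC hBX hCX hU] at he
  rw [inter_union_distrib_left, inter_union_distrib_left, card_union_of_disjoint (hd hAC),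
    card_union_of_disjoint (hd hBC), Nat.even_iff, Nat.even_iff]
  omega

/-- If a set `S` meets every hyperedge of a copy of `Fsim t` in an even number of vertices, then
it contains neither `f_5` nor any of the copies of `f_8`. -/
theorem notMem_of_even_card_inter_Fsim {V : Type*} [DecidableEq V] {t : ℕ}
    (f : Fin 7 ⊕ Fin t ↪ V) (S : Finset V) (h : ∀ e ∈ Fsim t, Even #(e.image f ∩ S)) :
    f (Sum.inl 4) ∉ S ∧ ∀ j, f (Sum.inr j) ∉ S := by
  let χ (w : Fin 7 ⊕ Fin t) : ZMod 2 := if f w ∈ S then 1 else 0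
  have hχ {w} : χ w = 0 ↔ f w ∉ S := by simp [χ]
  have hsum (e) (he : e ∈ Fsim t) : ∑ w ∈ e, χ w = 0 := by
    have h0 := (ZMod.natCast_eq_zero_iff_even).2 (h e he)
    rw [← filter_mem_eq_inter, card_filter, sum_image f.injective.injOn] at h0
    simpa [χ] using h0
  have h1 := hsum {Sum.inl 0, Sum.inl 1, Sum.inl 2} (by simp [Fsim])
  have h2 := hsum {Sum.inl 0, Sum.inl 1, Sum.inl 3} (by simp [Fsim])
  have h3 := hsum {Sum.inl 2, Sum.inl 3, Sum.inl 4} (by simp [Fsim])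
  have h4 := hsum {Sum.inl 4, Sum.inl 5, Sum.inl 6} (by simp [Fsim])
  have h5 (j) := hsum {Sum.inl 5, Sum.inl 6, Sum.inr j} (by simp [Fsim])
  rw [sum_insert (by simp), sum_pair (by simp)] at h1 h2 h3 h4
  have htwo : (2 : ZMod 2) = 0 := rfl
  have hfive : χ (Sum.inl 4) = 0 := by
    linear_combination h3 - h1 - h2 + (χ (Sum.inl 0) + χ (Sum.inl 1)) * htwo
  refine ⟨hχ.1 hfive, fun j => hχ.1 ?_⟩
  have h5 := h5 j
  rw [sum_insert (by simp), sum_pair (by simp)] at h5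
  linear_combination h5 - h4 + hfive

theorem not_hasCopy_simConstr_Fsim {n t : ℕ} {A B C X : Finset (Fin n)}
    (hAB : Disjoint A B) (hAC : Disjoint A C) (hAX : Disjoint A X)
    (hBC : Disjoint B C) (hBX : Disjoint B X) (hCX : Disjoint C X)
    (hU : A ∪ B ∪ C ∪ X = univ) (hX : #X ≤ t) :
    ¬ HasCopy (simConstr n A B C X) (Fsim t) := by
  rintro ⟨f, hf⟩
  have heven (e) (he : e ∈ Fsim t) :=
    even_card_inter_of_mem_simConstr hAB hAC hAX hBC hBX hCX hU (hf e he)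
  obtain ⟨hAC5, hAC8⟩ := notMem_of_even_card_inter_Fsim f (A ∪ C) fun e he => (heven e he).1
  obtain ⟨hBC5, hBC8⟩ := notMem_of_even_card_inter_Fsim f (B ∪ C) fun e he => (heven e he).2
  have hmem {v : Fin n} (h : v ∉ A ∪ C) (h' : v ∉ B ∪ C) : v ∈ X := by
    have := hU ▸ mem_univ v
    simp only [mem_union] at this h h'
    tauto
  have hsub : (insert (Sum.inl 4) (univ.image Sum.inr)).image f ⊆ X := by
    simp only [image_insert, insert_subset_iff, image_image, image_subset_iff]
    exact ⟨hmem hAC5 hBC5, fun j _ => hmem (hAC8 j) (hBC8 j)⟩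
  have hle := card_le_card hsub
  rw [card_image_of_injective _ f.injective, card_insert_of_notMem (by simp),
    card_image_of_injective _ Sum.inr_injective, card_univ, Fintype.card_fin] at hle
  omega

theorem statement7 (t : ℕ) (ht : 1 ≤ t) :
    ∃ n0 : ℕ, ∀ n : ℕ, n ≥ n0 →
    ∀ a b c : ℕ, 0 < a → 0 < b → 0 < c → a + b + c = n - t →
    ∀ A B C X : Finset (Fin n),
      A.card = a → B.card = b → C.card = c → X.card = t →
      Disjoint A B → Disjoint A C → Disjoint A X →
      Disjoint B C → Disjoint B X → Disjoint C X →
      A ∪ B ∪ C ∪ X = Finset.univ →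
      ¬ HasCopy (simConstr n A B C X) (Fsim t) ∧
      (simConstr n A B C X).card =
        a*b*c + t*(a.choose 2 + b.choose 2 + c.choose 2) + t.choose 3 := by
  refine ⟨0, ?_⟩
  rintro n - a b c - - - - A B C X rfl rfl rfl rfl hAB hAC hAX hBC hBX hCX hU
  exact ⟨not_hasCopy_simConstr_Fsim hAB hAC hAX hBC hBX hCX hU le_rfl,
    card_simConstr hAB hAC hAX hBC hBX hCX hU⟩
end

section
/- For every integer t ≥ 1 there exists n_0 such that for all n ≥ n_0: the maximum of abc + t(C(a,2) + C(b,2) + C(c,2)) over positive integers a, b, c with a + b + c = n − t is attained when a, b, c pairwise differ by at most 1. -/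
open Finset

theorem two_mul_choose_two_cast (x : ℕ) : 2 * ((x.choose 2 : ℕ) : ℤ) = x * (x - 1) := by
  induction x with
  | zero => simp
  | succ m ih =>
    rw [Nat.choose_succ_succ' m 1, Nat.choose_one_right]
    push_cast
    linear_combination ih

/-- Among integer triples of sum `3 * k + 1`, a triple of nonnegative integers with an entry
exceeding `k` has product at most that of the balanced triple. -/
theorem mul_le_of_sum_eq_three_mul_add_one {x y z k : ℤ} (hx : 0 ≤ x) (hy : 0 ≤ y)
    (hk : 0 ≤ k) (hs : x + y + z = 3 * k + 1) (hz : k + 1 ≤ z) :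
    x * y * z ≤ k * k * (k + 1) := by
  obtain ⟨j, rfl⟩ : ∃ j, z = k + 1 + j := ⟨z - k - 1, by ring⟩
  have hj : 0 ≤ j := by omega
  rcases hk.eq_or_lt with rfl | hk
  · have hx0 : x = 0 := by omega
    simp [hx0]
  have hxy : 4 * (x * y) ≤ (2 * k - j) ^ 2 := by
    have : 2 * k - j = x + y := by omega
    rw [this]
    nlinarith [sq_nonneg (x - y)]
  have hjk : 0 ≤ 2 * k - j := by omega
  have h := mul_le_mul_of_nonneg_right hxy (by omega : 0 ≤ k + 1 + j)
  have h1 : 0 ≤ j ^ 2 * (2 * k - j) := by positivity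
  have h2 : 0 ≤ j ^ 2 * (k - 1) := mul_nonneg (sq_nonneg _) (by omega)
  have h3 : 0 ≤ k * j := by positivity
  nlinarith

/-- Among integer triples of sum `3 * k + 2`, a triple of nonnegative integers with an entry
at most `k` has product at most that of the balanced triple. -/
theorem mul_le_of_sum_eq_three_mul_add_two {x y z k : ℤ}
    (hz0 : 0 ≤ z) (hs : x + y + z = 3 * k + 2) (hz : z ≤ k) :
    x * y * z ≤ k * (k + 1) * (k + 1) := by
  obtain ⟨j, rfl⟩ : ∃ j, z = k - j := ⟨k - z, by ring⟩
  have hj : 0 ≤ j := by omega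
  have hk : 0 ≤ k := by omega
  have hxy : 4 * (x * y) ≤ (2 * k + 2 + j) ^ 2 := by
    have : 2 * k + 2 + j = x + y := by omega
    rw [this]
    nlinarith [sq_nonneg (x - y)]
  have h := mul_le_mul_of_nonneg_right hxy hz0
  have h1 : 0 ≤ j ^ 2 * k := by positivity
  have h2 : 0 ≤ j ^ 3 := by positivity
  have h3 : 0 ≤ k * j := by positivity
  nlinarith [sq_nonneg j]

theorem mul_le_of_sum_eq_three_mul {x y z k : ℤ} (hx : 0 ≤ x) (hy : 0 ≤ y) (hz : 0 ≤ z)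
    (hs : x + y + z = 3 * k) : x * y * z ≤ k * k * k := by
  have h : 27 * (x * y * z) ≤ (x + y + z) ^ 3 := by
    nlinarith [mul_nonneg hx (sq_nonneg (y - z)), mul_nonneg hy (sq_nonneg (x - z)),
      mul_nonneg hz (sq_nonneg (x - y)), mul_nonneg hx (sq_nonneg (x - y)),
      mul_nonneg hx (sq_nonneg (x - z)), mul_nonneg hy (sq_nonneg (x - y)),
      mul_nonneg hy (sq_nonneg (y - z)), mul_nonneg hz (sq_nonneg (x - z)),
      mul_nonneg hz (sq_nonneg (y - z))]
  rw [hs] at h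
  nlinarith

/-- A balanced triple maximizes the product among nonnegative integer triples of given sum. -/
theorem mul_le_mul_of_balanced {x y z p q r : ℤ} (hx : 0 ≤ x) (hy : 0 ≤ y) (hz : 0 ≤ z)
    (hs : x + y + z = p + q + r) (hpq : p ≤ q + 1) (hqp : q ≤ p + 1) (hpr : p ≤ r + 1)
    (hrp : r ≤ p + 1) (hqr : q ≤ r + 1) (hrq : r ≤ q + 1) : x * y * z ≤ p * q * r := by
  obtain ⟨k, hk⟩ : ∃ k : ℤ, k = (x + y + z) / 3 := ⟨_, rfl⟩
  have hk0 : 0 ≤ k := by omega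
  have hM : x + y + z = 3 * k ∨ x + y + z = 3 * k + 1 ∨ x + y + z = 3 * k + 2 := by omega
  rcases hM with h | h | h
  · have hp : p = k := by omega
    have hq : q = k := by omega
    have hr : r = k := by omega
    rw [hp, hq, hr]
    exact mul_le_of_sum_eq_three_mul hx hy hz h
  · have hb : x * y * z ≤ k * k * (k + 1) := by
      rcases (by omega : k + 1 ≤ x ∨ k + 1 ≤ y ∨ k + 1 ≤ z) with h' | h' | h'
      · linarith [mul_le_of_sum_eq_three_mul_add_one hy hz hk0 (by omega) h']
      · linarith [mul_le_of_sum_eq_three_mul_add_one hx hz hk0 (by omega) h']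
      · exact mul_le_of_sum_eq_three_mul_add_one hx hy hk0 h h'
    have hv : (p = k ∧ q = k ∧ r = k + 1) ∨ (p = k ∧ q = k + 1 ∧ r = k) ∨
        (p = k + 1 ∧ q = k ∧ r = k) := by omega
    rcases hv with ⟨rfl, h1, h2⟩ | ⟨rfl, h1, h2⟩ | ⟨h0, rfl, h2⟩ <;> subst_vars <;> linarith
  · have hb : x * y * z ≤ k * (k + 1) * (k + 1) := by
      rcases (by omega : x ≤ k ∨ y ≤ k ∨ z ≤ k) with h' | h' | h'
      · linarith [mul_le_of_sum_eq_three_mul_add_two hx (by omega : y + z + x = _) h']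
      · linarith [mul_le_of_sum_eq_three_mul_add_two hy (by omega : x + z + y = _) h']
      · exact mul_le_of_sum_eq_three_mul_add_two hz h h'
    have hv : (p = k ∧ q = k + 1 ∧ r = k + 1) ∨ (p = k + 1 ∧ q = k + 1 ∧ r = k) ∨
        (p = k + 1 ∧ q = k ∧ r = k + 1) := by omega
    rcases hv with ⟨h0, h1, h2⟩ | ⟨h0, h1, h2⟩ | ⟨h0, h1, h2⟩ <;> rw [h0, h1, h2] <;> linarith

/-- If two entries of a triple lie in `[-t, 0]`, its product is at most that of any balanced
triple of large entries and the same sum. -/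
theorem mul_le_mul_of_nonpos_of_large {t x y z p q r : ℤ} (ht : 1 ≤ t) (hx : -t ≤ x)
    (hx0 : x ≤ 0) (hy : -t ≤ y) (hy0 : y ≤ 0) (hs : x + y + z = p + q + r) (hp : 10 * t ≤ p)
    (hpq : p ≤ q + 1) (hqp : q ≤ p + 1) (hpr : p ≤ r + 1) (hrp : r ≤ p + 1) :
    x * y * z ≤ p * q * r := by
  have hz : z ≤ 4 * p := by omega
  have hxy : x * y ≤ t * t := by nlinarith
  have hxy0 : 0 ≤ x * y := mul_nonneg_of_nonpos_of_nonpos hx0 hy0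
  have hqr : (2 * t) * (2 * t) ≤ q * r :=
    mul_le_mul (by omega) (by omega) (by omega) (by omega)
  have h1 : x * y * z ≤ x * y * (4 * p) := mul_le_mul_of_nonneg_left hz hxy0
  have h2 : x * y * (4 * p) ≤ t * t * (4 * p) := mul_le_mul_of_nonneg_right hxy (by omega)
  have h3 : p * ((2 * t) * (2 * t)) ≤ p * (q * r) := mul_le_mul_of_nonneg_left hqr (by omega)
  linarith

/-- A balanced triple of large entries maximizes the product among the integer triples of the
same sum with entries at least `-t`. -/
theorem mul_le_mul_of_balanced_of_large {t x y z p q r : ℤ} (ht : 1 ≤ t) (hx : -t ≤ x)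
    (hy : -t ≤ y) (hz : -t ≤ z) (hs : x + y + z = p + q + r) (hp : 10 * t ≤ p)
    (hpq : p ≤ q + 1) (hqp : q ≤ p + 1) (hpr : p ≤ r + 1) (hrp : r ≤ p + 1) (hqr : q ≤ r + 1)
    (hrq : r ≤ q + 1) : x * y * z ≤ p * q * r := by
  have hpos : 0 ≤ p * q * r := mul_nonneg (mul_nonneg (by omega) (by omega)) (by omega)
  rcases le_total x 0 with hx0 | hx0 <;> rcases le_total y 0 with hy0 | hy0 <;>
    rcases le_total z 0 with hz0 | hz0
  · omega
  · exact mul_le_mul_of_nonpos_of_large ht hx hx0 hy hy0 hs hp hpq hqp hpr hrp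
  · linarith [mul_le_mul_of_nonpos_of_large ht hx hx0 hz hz0 (by omega : x + z + y = _)
      hp hpq hqp hpr hrp]
  · exact (mul_nonpos_of_nonpos_of_nonneg (mul_nonpos_of_nonpos_of_nonneg hx0 hy0) hz0).trans hpos
  · linarith [mul_le_mul_of_nonpos_of_large ht hy hy0 hz hz0 (by omega : y + z + x = _)
      hp hpq hqp hpr hrp]
  · exact (mul_nonpos_of_nonpos_of_nonneg (mul_nonpos_of_nonneg_of_nonpos hx0 hy0) hz0).trans hpos
  · exact (mul_nonpos_of_nonneg_of_nonpos (mul_nonneg hx0 hy0) hz0).trans hpos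
  · exact mul_le_mul_of_balanced hx0 hy0 hz0 hs hpq hqp hpr hrp hqr hrq

theorem statement8 (t : ℕ) (ht : 1 ≤ t) :
    ∃ n0 : ℕ, ∀ n : ℕ, n ≥ n0 →
    ∀ a b c : ℕ, 0 < a → 0 < b → 0 < c → a + b + c = n - t →
    a ≤ b + 1 → b ≤ a + 1 → a ≤ c + 1 → c ≤ a + 1 → b ≤ c + 1 → c ≤ b + 1 →
    ∀ a' b' c' : ℕ, 0 < a' → 0 < b' → 0 < c' → a' + b' + c' = n - t →
      a'*b'*c' + t*(a'.choose 2 + b'.choose 2 + c'.choose 2) ≤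
        a*b*c + t*(a.choose 2 + b.choose 2 + c.choose 2) := by
  refine ⟨100 * t, fun n hn a b c _ _ _ hs hab hba hac hca hbc hcb a' b' c' _ _ _ hs' => ?_⟩
  have key : ((a' : ℤ) - t) * (b' - t) * (c' - t) ≤ (a - t) * (b - t) * (c - t) :=
    mul_le_mul_of_balanced_of_large (t := t) (by omega) (by omega) (by omega) (by omega)
      (by omega) (by omega) (by omega) (by omega) (by omega) (by omega) (by omega) (by omega)
  have hsum : (a' : ℤ) + b' + c' = a + b + c := by omega
  have expand : ∀ x y z : ℕ, 2 * ((x : ℤ) * y * z +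
      t * ((x.choose 2 : ℕ) + (y.choose 2 : ℕ) + (z.choose 2 : ℕ))) =
      2 * (((x : ℤ) - t) * (y - t) * (z - t)) + t * (x + y + z) ^ 2
        - (t + 2 * t ^ 2) * (x + y + z) + 2 * t ^ 3 := by
    intro x y z
    linear_combination (t : ℤ) * (two_mul_choose_two_cast x + two_mul_choose_two_cast y +
      two_mul_choose_two_cast z)
  have h := expand a b c
  have h' := expand a' b' c'
  rw [hsum] at h'
  zify
  linarith
end
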